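/- Let l ≥ 2, let ε_k → 0 with ε_k > 0, and let u_k : B_1 → ℝ^l be smooth sphere-valued ε_k-harmonic maps with sup_k ∫_{B_1} (|∇u_k|² + ε_k |Δu_k|²) dx < ∞. Let r_k → 0 with r_k > 0 and let ω : ℝ² → ℝ^l be a smooth nonconstant map with 0 < ∫_{ℝ²} |Δω|² dx < ∞ such that v_k(y) = u_k(r_k y) converge to ω in C³ on every compact subset of ℝ². Assume the single-bubble neck condition: for every δ > 0 there exist R ≥ 1, R₀ ∈ (0,1) and K such that for all k ≥ K, (a) |∇^t u_k(x)| ≤ √δ |x|^{−t} for t ∈ {1,2,3} and all x with 2Rr_k ≤ |x| ≤ R₀/4, and (b) ∫_{A(a,2a)} (|∇u_k|² + ε_k |Δu_k|²) dx ≤ δ for every a with Rr_k < a < R₀/2. Assume further that μ = lim_{k→∞} (ε_k / r_k²) log(1/r_k) exists. Then the generalised energy identity for the neck energy holds: lim_{R₀→0} lim_{R→∞} lim_{k→∞} ∫_{A(R r_k, R₀)} (|∇u_k|² + ε_k |Δu_k|²) dx = 2μ ∫_{ℝ²} |Δω|² dx, in the sense that the iterated limits of both the limsup and liminf in k exist and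 equal 2μ ∫_{ℝ²} |Δω|² dx. -/

import Mathlib

open scoped RealInnerProductSpace
open Filter MeasureTheory Metric

noncomputable section

/-- The plane `ℝ²` as a Euclidean space. -/
abbrev E2 : Type := EuclideanSpace ℝ (Fin 2)

/-- Euclidean space `ℝ^l`. -/
abbrev Eu (l : ℕ) : Type := EuclideanSpace ℝ (Fin l)

/-- Partial derivative `∂_α u` of a map `u : ℝ² → ℝ^l`. -/
def pd {l : ℕ} (α : Fin 2) (u : E2 → Eu l) (x : E2) : Eu l :=
  fderiv ℝ u x (EuclideanSpace.single α 1)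

/-- Partial derivative `∂_α f` of a scalar function `f : ℝ² → ℝ`. -/
def pds (α : Fin 2) (f : E2 → ℝ) (x : E2) : ℝ :=
  fderiv ℝ f x (EuclideanSpace.single α 1)

/-- The componentwise Laplacian `Δu = ∂₁∂₁u + ∂₂∂₂u`. -/
def lap {l : ℕ} (u : E2 → Eu l) (x : E2) : Eu l :=
  pd 0 (pd 0 u) x + pd 1 (pd 1 u) x

/-- `|∇u|² = |∂₁u|² + |∂₂u|²`. -/
def gradSq {l : ℕ} (u : E2 → Eu l) (x : E2) : ℝ :=
  ‖pd 0 u x‖ ^ 2 + ‖pd 1 u x‖ ^ 2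

/-- The harmonic stress-energy tensor `S¹_{αβ}(u) = ½|∇u|²δ_{αβ} − ⟨∂_α u, ∂_β u⟩`. -/
def S1 {l : ℕ} (u : E2 → Eu l) (α β : Fin 2) (x : E2) : ℝ :=
  (1 / 2) * gradSq u x * (if α = β then 1 else 0) - ⟪pd α u x, pd β u x⟫

/-- Jiang's biharmonic stress-energy tensor
`S²_{αβ}(u) = ½|Δu|²δ_{αβ} + ∑_γ ⟨∂_γ u, ∂_γ Δu⟩ δ_{αβ} − ⟨∂_α u, ∂_β Δu⟩ − ⟨∂_β u, ∂_α Δu⟩`. -/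
def S2 {l : ℕ} (u : E2 → Eu l) (α β : Fin 2) (x : E2) : ℝ :=
  (1 / 2) * ‖lap u x‖ ^ 2 * (if α = β then 1 else 0)
    + (∑ γ : Fin 2, ⟪pd γ u x, pd γ (lap u) x⟫) * (if α = β then 1 else 0)
    - ⟪pd α u x, pd β (lap u) x⟫ - ⟪pd β u x, pd α (lap u) x⟫

/-- A sphere-valued map `u : Ω → S^{l-1} ⊂ ℝ^l` is `ε`-harmonic if `Δu − εΔ²u` is a real
scalar multiple of `u` at every point of `Ω` (the Euler–Lagrange equation of the ε-energy). -/
def IsEpsHarmonic {l : ℕ} (ε : ℝ) (Ω : Set E2) (u : E2 → Eu l) : Prop :=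
  ∀ x ∈ Ω, ∃ c : ℝ, lap u x - ε • lap (lap u) x = c • u x

/-- The point `(a, b) ∈ ℝ²`. -/
def pt (a b : ℝ) : E2 := (WithLp.equiv 2 (Fin 2 → ℝ)).symm ![a, b]

/-- The radial derivative `∂_r u(x) = Du(x)[x/|x|]`. -/
def radialDeriv {l : ℕ} (u : E2 → Eu l) (x : E2) : Eu l :=
  fderiv ℝ u x (‖x‖⁻¹ • x)

/-- The angular derivative `∂_θ u(x) = Du(x)[(-x₂, x₁)]`, so that
`|∇u|² = |∂_r u|² + |x|⁻²|∂_θ u|²`. -/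
def angularDeriv {l : ℕ} (u : E2 → Eu l) (x : E2) : Eu l :=
  fderiv ℝ u x (pt (-(x 1)) (x 0))

/-- The circle integral `∫_{∂B_t} f dS = ∫₀^{2π} f(t cos θ, t sin θ) t dθ`. -/
def circInt (t : ℝ) (f : E2 → ℝ) : ℝ :=
  ∫ θ in (0:ℝ)..(2 * Real.pi), f (pt (t * Real.cos θ) (t * Real.sin θ)) * t

/-- The open annulus `A(p,q) = {x ∈ ℝ² : p < |x| < q}`. -/
def ann (p q : ℝ) : Set E2 := {x : E2 | p < ‖x‖ ∧ ‖x‖ < q}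

/-- The `ε`-energy density `|∇u|² + ε|Δu|²`. -/
def eDen {l : ℕ} (ε : ℝ) (u : E2 → Eu l) (x : E2) : ℝ :=
  gradSq u x + ε * ‖lap u x‖ ^ 2

section

open scoped ContDiff

section Calculus

variable {l : ℕ}

theorem contDiff_pd {u : E2 → Eu l} (hu : ContDiff ℝ ∞ u) (α : Fin 2) :
    ContDiff ℝ ∞ (pd α u) :=
  (hu.fderiv_right (m := ∞) (by simp)).clm_apply contDiff_const

theorem contDiff_lap {u : E2 → Eu l} (hu : ContDiff ℝ ∞ u) : ContDiff ℝ ∞ (lap u) :=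
  (contDiff_pd (contDiff_pd hu 0) 0).add (contDiff_pd (contDiff_pd hu 1) 1)

@[fun_prop]
theorem contDiff_inner_Eu {f g : E2 → Eu l} (hf : ContDiff ℝ ∞ f) (hg : ContDiff ℝ ∞ g) :
    ContDiff ℝ ∞ (fun x => ⟪f x, g x⟫) := hf.inner ℝ hg

theorem contDiff_coord (α : Fin 2) : ContDiff ℝ ∞ (fun x : E2 => x α) := by fun_prop

theorem ContDiff.differentiableAt_top {F G : Type*} [NormedAddCommGroup F] [NormedSpace ℝ F]
    [NormedAddCommGroup G] [NormedSpace ℝ G] {f : F → G} (hf : ContDiff ℝ ∞ f) (x : F) :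
    DifferentiableAt ℝ f x :=
  (hf.differentiable (by simp)).differentiableAt

theorem pd_add {f g : E2 → Eu l} (hf : ContDiff ℝ ∞ f) (hg : ContDiff ℝ ∞ g) (α : Fin 2)
    (x : E2) : pd α (fun y => f y + g y) x = pd α f x + pd α g x := by
  simp only [pd]
  rw [fderiv_fun_add (hf.differentiableAt_top x) (hg.differentiableAt_top x)]
  rfl

theorem pd_sub {f g : E2 → Eu l} (hf : ContDiff ℝ ∞ f) (hg : ContDiff ℝ ∞ g) (α : Fin 2)
    (x : E2) : pd α (fun y => f y - g y) x = pd α f x - pd α g x := by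
  simp only [pd]
  rw [fderiv_fun_sub (hf.differentiableAt_top x) (hg.differentiableAt_top x)]
  rfl

theorem pd_smul {c : E2 → ℝ} {g : E2 → Eu l} (hc : ContDiff ℝ ∞ c) (hg : ContDiff ℝ ∞ g)
    (α : Fin 2) (x : E2) :
    pd α (fun y => c y • g y) x = pds α c x • g x + c x • pd α g x := by
  simp only [pd, pds]
  rw [fderiv_fun_smul (hc.differentiableAt_top x) (hg.differentiableAt_top x)]
  simp [add_comm]

theorem pds_add {f g : E2 → ℝ} (hf : ContDiff ℝ ∞ f) (hg : ContDiff ℝ ∞ g) (α : Fin 2)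
    (x : E2) : pds α (fun y => f y + g y) x = pds α f x + pds α g x := by
  simp only [pds]
  rw [fderiv_fun_add (hf.differentiableAt_top x) (hg.differentiableAt_top x)]
  rfl

theorem pds_sub {f g : E2 → ℝ} (hf : ContDiff ℝ ∞ f) (hg : ContDiff ℝ ∞ g) (α : Fin 2)
    (x : E2) : pds α (fun y => f y - g y) x = pds α f x - pds α g x := by
  simp only [pds]
  rw [fderiv_fun_sub (hf.differentiableAt_top x) (hg.differentiableAt_top x)]
  rfl

theorem pds_mul {f g : E2 → ℝ} (hf : ContDiff ℝ ∞ f) (hg : ContDiff ℝ ∞ g) (α : Fin 2)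
    (x : E2) : pds α (fun y => f y * g y) x = pds α f x * g x + f x * pds α g x := by
  simp only [pds]
  rw [fderiv_fun_mul (hf.differentiableAt_top x) (hg.differentiableAt_top x)]
  simp only [_root_.add_apply, _root_.smul_apply, smul_eq_mul]
  ring

theorem pds_const (c : ℝ) (α : Fin 2) (x : E2) : pds α (fun _ => c) x = 0 := by
  simp [pds]

theorem pds_inner {f g : E2 → Eu l} (hf : ContDiff ℝ ∞ f) (hg : ContDiff ℝ ∞ g) (α : Fin 2)
    (x : E2) : pds α (fun y => ⟪f y, g y⟫) x = ⟪pd α f x, g x⟫ + ⟪f x, pd α g x⟫ := by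
  simp only [pds, pd]
  rw [fderiv_inner_apply ℝ (hf.differentiableAt_top x) (hg.differentiableAt_top x)]
  ring

theorem pds_coord (α β : Fin 2) (x : E2) :
    pds α (fun y : E2 => y β) x = if α = β then 1 else 0 := by
  simp only [pds]
  have : (fun y : E2 => y β) = (EuclideanSpace.proj (𝕜 := ℝ) β : E2 →L[ℝ] ℝ) := rfl
  rw [this, ContinuousLinearMap.fderiv]
  simp [eq_comm]

theorem pd_comm {u : E2 → Eu l} (hu : ContDiff ℝ ∞ u) (α β : Fin 2) (x : E2) :
    pd α (pd β u) x = pd β (pd α u) x := by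
  have h1 : DifferentiableAt ℝ (fderiv ℝ u) x :=
    (hu.fderiv_right (m := ∞) (by simp)).differentiableAt_top x
  have h2 : ∀ γ κ : Fin 2, pd γ (pd κ u) x =
      fderiv ℝ (fderiv ℝ u) x (EuclideanSpace.single γ 1) (EuclideanSpace.single κ 1) := by
    intro γ κ
    simp only [pd]
    change fderiv ℝ (fun y => fderiv ℝ u y (EuclideanSpace.single κ 1)) x _ = _
    rw [fderiv_clm_apply h1 (by fun_prop)]
    simp
  rw [h2, h2]
  have := (hu.contDiffAt (x := x)).isSymmSndFDerivAt (by
    rw [minSmoothness_of_isRCLikeNormedField]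
    exact WithTop.coe_le_coe.2 (le_top (a := (2 : ℕ∞))))
  exact this _ _

theorem pd_comm' {u : E2 → Eu l} (hu : ContDiff ℝ ∞ u) :
    pd 1 (pd 0 u) = pd 0 (pd 1 u) := funext fun x => pd_comm hu 1 0 x

end Calculus

section Rot

variable {l : ℕ}

/-- The derivative of `u` along the rotation field `(-x₂, x₁)`. -/
def rot (u : E2 → Eu l) (x : E2) : Eu l := x 0 • pd 1 u x - x 1 • pd 0 u x

theorem contDiff_rot {u : E2 → Eu l} (hu : ContDiff ℝ ∞ u) : ContDiff ℝ ∞ (rot u) :=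
  ((contDiff_coord 0).smul (contDiff_pd hu 1)).sub ((contDiff_coord 1).smul (contDiff_pd hu 0))

theorem pd_rot {u : E2 → Eu l} (hu : ContDiff ℝ ∞ u) (α : Fin 2) (x : E2) :
    pd α (rot u) x = pds α (fun y : E2 => y 0) x • pd 1 u x + x 0 • pd α (pd 1 u) x
      - (pds α (fun y : E2 => y 1) x • pd 0 u x + x 1 • pd α (pd 0 u) x) := by
  rw [← pd_smul (contDiff_coord 0) (contDiff_pd hu 1),
    ← pd_smul (contDiff_coord 1) (contDiff_pd hu 0), ← pd_sub]
  · rfl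
  · exact (contDiff_coord 0).smul (contDiff_pd hu 1)
  · exact (contDiff_coord 1).smul (contDiff_pd hu 0)

theorem pd_zero_rot {u : E2 → Eu l} (hu : ContDiff ℝ ∞ u) :
    pd 0 (rot u) = fun x => pd 1 u x + rot (pd 0 u) x := by
  funext x
  rw [pd_rot hu, pds_coord, pds_coord, rot, pd_comm' hu]
  simp
  abel

theorem pd_one_rot {u : E2 → Eu l} (hu : ContDiff ℝ ∞ u) :
    pd 1 (rot u) = fun x => rot (pd 1 u) x - pd 0 u x := by
  funext x
  rw [pd_rot hu, pds_coord, pds_coord, rot, pd_comm' hu]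
  simp
  abel

theorem lap_rot {u : E2 → Eu l} (hu : ContDiff ℝ ∞ u) (x : E2) :
    lap (rot u) x = rot (lap u) x := by
  have h0 := contDiff_pd hu 0
  have h1 := contDiff_pd hu 1
  have h00 := contDiff_pd h0 0
  have h11 := contDiff_pd h1 1
  have e : ∀ α, pd α (lap u) x = pd α (pd 0 (pd 0 u)) x + pd α (pd 1 (pd 1 u)) x :=
    fun α => pd_add h00 h11 α x
  rw [lap, pd_zero_rot hu, pd_one_rot hu, pd_add h1 (contDiff_rot h0),
    pd_sub (contDiff_rot h1) h0, pd_zero_rot h0, pd_one_rot h1, rot, e, e]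
  simp only [rot, pd_comm' hu, smul_add]
  abel

end Rot

section Pointwise

variable {l : ℕ}

theorem inner_pd_eq_zero {u : E2 → Eu l} (hu : ContDiff ℝ ∞ u) {U : Set E2} (hU : IsOpen U)
    (h1 : ∀ x ∈ U, ‖u x‖ = 1) {x : E2} (hx : x ∈ U) (α : Fin 2) : ⟪u x, pd α u x⟫ = 0 := by
  have h := pds_inner hu hu α x
  have h2 : pds α (fun y => ⟪u y, u y⟫) x = 0 := by
    have : (fun y => ⟪u y, u y⟫) =ᶠ[nhds x] fun _ => (1 : ℝ) := by
      filter_upwards [hU.mem_nhds hx] with y hy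
      rw [real_inner_self_eq_norm_sq, h1 y hy, one_pow]
    simp only [pds]
    rw [this.fderiv_eq]
    simp
  rw [h2, real_inner_comm] at h
  linarith

theorem inner_pd_pd {u : E2 → Eu l} (hu : ContDiff ℝ ∞ u) {U : Set E2} (hU : IsOpen U)
    (h1 : ∀ x ∈ U, ‖u x‖ = 1) {x : E2} (hx : x ∈ U) (α β : Fin 2) :
    ⟪u x, pd α (pd β u) x⟫ = - ⟪pd α u x, pd β u x⟫ := by
  have h := pds_inner hu (contDiff_pd hu β) α x
  have h2 : pds α (fun y => ⟪u y, pd β u y⟫) x = 0 := by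
    have : (fun y => ⟪u y, pd β u y⟫) =ᶠ[nhds x] fun _ => (0 : ℝ) := by
      filter_upwards [hU.mem_nhds hx] with y hy
      exact inner_pd_eq_zero hu hU h1 hy β
    simp only [pds]
    rw [this.fderiv_eq]
    simp
  rw [h2] at h
  linarith

theorem inner_lap {u : E2 → Eu l} (hu : ContDiff ℝ ∞ u) {U : Set E2} (hU : IsOpen U)
    (h1 : ∀ x ∈ U, ‖u x‖ = 1) {x : E2} (hx : x ∈ U) : ⟪u x, lap u x⟫ = - gradSq u x := by
  rw [lap, inner_add_right, inner_pd_pd hu hU h1 hx, inner_pd_pd hu hU h1 hx, gradSq,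
    real_inner_self_eq_norm_sq, real_inner_self_eq_norm_sq]
  ring

/-- The tangential projection of the second rotational derivative of a sphere-valued map. -/
def rotTest (u : E2 → Eu l) (x : E2) : Eu l := rot (rot u) x + ⟪rot u x, rot u x⟫ • u x

theorem contDiff_rotTest {u : E2 → Eu l} (hu : ContDiff ℝ ∞ u) : ContDiff ℝ ∞ (rotTest u) :=
  (contDiff_rot (contDiff_rot hu)).add
    (((contDiff_rot hu).inner ℝ (contDiff_rot hu)).smul hu)

theorem rot_rot {u : E2 → Eu l} (hu : ContDiff ℝ ∞ u) (x : E2) :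
    rot (rot u) x = x 0 • (rot (pd 1 u) x - pd 0 u x) - x 1 • (pd 1 u x + rot (pd 0 u) x) := by
  rw [rot, pd_zero_rot hu, pd_one_rot hu]

theorem inner_rotTest {u : E2 → Eu l} (hu : ContDiff ℝ ∞ u) {U : Set E2} (hU : IsOpen U)
    (h1 : ∀ x ∈ U, ‖u x‖ = 1) {x : E2} (hx : x ∈ U) : ⟪u x, rotTest u x⟫ = 0 := by
  have a := inner_pd_eq_zero hu hU h1 hx
  have b := inner_pd_pd hu hU h1 hx
  have hn : ⟪u x, u x⟫ = 1 := by rw [real_inner_self_eq_norm_sq, h1 x hx, one_pow]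
  rw [rotTest, rot_rot hu]
  simp only [rot, inner_add_right, inner_sub_right, real_inner_smul_right, a, b,
    inner_sub_left, real_inner_smul_left, hn,
    real_inner_comm (pd 1 u x) (pd 0 u x)]
  ring

/-- The components of the radial stress-energy vector field. -/
def stressField (ε : ℝ) (u : E2 → Eu l) (β : Fin 2) (x : E2) : ℝ :=
  ((1 / 2) * (⟪pd 0 u x, pd 0 u x⟫ + ⟪pd 1 u x, pd 1 u x⟫) * x β
      - ⟪x 0 • pd 0 u x + x 1 • pd 1 u x, pd β u x⟫)
    - ε * (((1 / 2) * ⟪lap u x, lap u x⟫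
        + (⟪pd 0 u x, pd 0 (lap u) x⟫ + ⟪pd 1 u x, pd 1 (lap u) x⟫)) * x β
      - ⟪x 0 • pd 0 u x + x 1 • pd 1 u x, pd β (lap u) x⟫
      - ⟪pd β u x, x 0 • pd 0 (lap u) x + x 1 • pd 1 (lap u) x⟫)

theorem contDiff_stressField {u : E2 → Eu l} (hu : ContDiff ℝ ∞ u) (ε : ℝ) (β : Fin 2) :
    ContDiff ℝ ∞ (stressField ε u β) := by
  have h0 := contDiff_pd hu 0
  have h1 := contDiff_pd hu 1
  have hb := contDiff_pd hu β
  have hw := contDiff_lap hu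
  have w0 := contDiff_pd hw 0
  have w1 := contDiff_pd hw 1
  have wb := contDiff_pd hw β
  unfold stressField
  fun_prop

theorem div_stressField {u : E2 → Eu l} (hu : ContDiff ℝ ∞ u) {ε c : ℝ} {x : E2}
    (hc : lap u x - ε • lap (lap u) x = c • u x) (h : ∀ α, ⟪u x, pd α u x⟫ = 0) :
    pds 0 (stressField ε u 0) x + pds 1 (stressField ε u 1) x = - (ε * ‖lap u x‖ ^ 2) := by
  have h0 := contDiff_pd hu 0
  have h1 := contDiff_pd hu 1
  have hw := contDiff_lap hu
  have w0 := contDiff_pd hw 0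
  have w1 := contDiff_pd hw 1
  have hx0 := contDiff_coord 0
  have hx1 := contDiff_coord 1
  have el : ∀ α, ⟪lap u x, pd α u x⟫ = ε * ⟪lap (lap u) x, pd α u x⟫ := by
    intro α
    rw [← real_inner_smul_left, ← sub_eq_zero, ← inner_sub_left, hc, real_inner_smul_left, h,
      mul_zero]
  have el0 := el 0
  have el1 := el 1
  rw [← real_inner_self_eq_norm_sq]
  unfold stressField
  simp (disch := fun_prop) only [pds_sub, pds_add, pds_mul, pds_const, pds_inner,
    pd_add, pd_smul, pds_coord, pd_comm' hu, pd_comm' hw]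
  have hl : lap u x = pd 0 (pd 0 u) x + pd 1 (pd 1 u) x := rfl
  have hll : lap (lap u) x = pd 0 (pd 0 (lap u)) x + pd 1 (pd 1 (lap u)) x := rfl
  simp only [hl, hll, inner_add_left, inner_add_right, real_inner_smul_left,
    real_inner_smul_right, reduceIte, one_ne_zero, zero_ne_one, Fin.isValue] at el0 el1 ⊢
  simp only [real_inner_comm] at el0 el1 ⊢
  linear_combination (-x 0) * el0 - x 1 * el1

/-- The vector field of the rotational energy identity. -/
def rotField (ε : ℝ) (u : E2 → Eu l) (β : Fin 2) (x : E2) : ℝ :=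
  (⟪pd β (rot u) x, rot u x⟫ + (if β = 0 then x 1 else - x 0) * ⟪lap u x, rot u x⟫)
    + ε * ⟪pd β (lap u) x, rotTest u x⟫

theorem contDiff_rotField {u : E2 → Eu l} (hu : ContDiff ℝ ∞ u) (ε : ℝ) (β : Fin 2) :
    ContDiff ℝ ∞ (rotField ε u β) := by
  have hr := contDiff_rot hu
  have hb := contDiff_pd hr β
  have hw := contDiff_lap hu
  have wb := contDiff_pd hw β
  have ht := contDiff_rotTest hu
  unfold rotField
  split_ifs <;> fun_prop

theorem div_rotField {u : E2 → Eu l} (hu : ContDiff ℝ ∞ u) {U : Set E2} (hU : IsOpen U)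
    (h1 : ∀ x ∈ U, ‖u x‖ = 1) {ε c : ℝ} {x : E2} (hx : x ∈ U)
    (hc : lap u x - ε • lap (lap u) x = c • u x) :
    pds 0 (rotField ε u 0) x + pds 1 (rotField ε u 1) x
      = gradSq (rot u) x - ‖rot u x‖ ^ 2 * gradSq u x
        + ε * (⟪pd 0 (lap u) x, pd 0 (rotTest u) x⟫ + ⟪pd 1 (lap u) x, pd 1 (rotTest u) x⟫) := by
  have hr := contDiff_rot hu
  have r0 := contDiff_pd hr 0
  have r1 := contDiff_pd hr 1
  have hw := contDiff_lap hu
  have w0 := contDiff_pd hw 0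
  have w1 := contDiff_pd hw 1
  have ht := contDiff_rotTest hu
  have hx0 := contDiff_coord 0
  have hx1 := contDiff_coord 1
  have hx1' : ContDiff ℝ ∞ (fun x : E2 => - x 0) := hx0.neg
  have hneg : pds 1 (fun y : E2 => - y 0) x = 0 := by
    have : (fun y : E2 => - y 0) = fun y => (fun _ => (0 : ℝ)) y - y 0 := by
      funext y; simp
    rw [this, pds_sub contDiff_const hx0, pds_const, pds_coord]
    simp
  have el : ⟪lap u x, rotTest u x⟫ = ε * ⟪lap (lap u) x, rotTest u x⟫ := by
    rw [← real_inner_smul_left, ← sub_eq_zero, ← inner_sub_left, hc, real_inner_smul_left,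
      inner_rotTest hu hU h1 hx, mul_zero]
  have eg : ⟪lap u x, u x⟫ = - gradSq u x := by
    rw [real_inner_comm, inner_lap hu hU h1 hx]
  have et : ⟪lap u x, rotTest u x⟫ = x 0 * ⟪lap u x, pd 1 (rot u) x⟫
      - x 1 * ⟪lap u x, pd 0 (rot u) x⟫ - ⟪rot u x, rot u x⟫ * gradSq u x := by
    conv_lhs => rw [rotTest, inner_add_right, real_inner_smul_right, eg, rot, inner_sub_right,
      real_inner_smul_right, real_inner_smul_right]
    ring
  have er : ⟪pd 0 (pd 0 (rot u)) x, rot u x⟫ + ⟪pd 1 (pd 1 (rot u)) x, rot u x⟫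
      = x 0 * ⟪pd 1 (lap u) x, rot u x⟫ - x 1 * ⟪pd 0 (lap u) x, rot u x⟫ := by
    have := lap_rot hu x
    rw [lap] at this
    rw [← inner_add_left, this, show rot (lap u) x = x 0 • pd 1 (lap u) x - x 1 • pd 0 (lap u) x
      from rfl, inner_sub_left, real_inner_smul_left, real_inner_smul_left]
  have hll : lap (lap u) x = pd 0 (pd 0 (lap u)) x + pd 1 (pd 1 (lap u)) x := rfl
  rw [hll, inner_add_left] at el
  rw [gradSq, ← real_inner_self_eq_norm_sq, ← real_inner_self_eq_norm_sq,
    ← real_inner_self_eq_norm_sq]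
  unfold rotField
  simp (disch := fun_prop) only [pds_add, pds_mul, pds_const, pds_inner, pds_coord, hneg,
    reduceIte, one_ne_zero, zero_ne_one, Fin.isValue]
  linear_combination er + et - el

end Pointwise

section Polar

theorem pt_eq (a b : ℝ) :
    pt a b = a • EuclideanSpace.single (0 : Fin 2) (1 : ℝ)
      + b • EuclideanSpace.single (1 : Fin 2) (1 : ℝ) := by
  ext i
  fin_cases i <;> simp [pt]

@[simp] theorem pt_zero (a b : ℝ) : (pt a b) 0 = a := rfl

@[simp] theorem pt_one (a b : ℝ) : (pt a b) 1 = b := rfl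

theorem norm_pt_sq (a b : ℝ) : ‖pt a b‖ ^ 2 = a ^ 2 + b ^ 2 := by
  rw [EuclideanSpace.norm_sq_eq]
  simp [Fin.sum_univ_two]

theorem norm_pt_polar {t : ℝ} (ht : 0 ≤ t) (θ : ℝ) :
    ‖pt (t * Real.cos θ) (t * Real.sin θ)‖ = t := by
  have h := norm_pt_sq (t * Real.cos θ) (t * Real.sin θ)
  have h2 : (t * Real.cos θ) ^ 2 + (t * Real.sin θ) ^ 2 = t ^ 2 := by
    linear_combination t ^ 2 * Real.sin_sq_add_cos_sq θ
  rw [h2] at h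
  exact (pow_left_inj₀ (norm_nonneg _) ht two_ne_zero).1 h

theorem contDiff_pt_comp {F : Type*} [NormedAddCommGroup F] [NormedSpace ℝ F] {a b : F → ℝ}
    (ha : ContDiff ℝ ∞ a) (hb : ContDiff ℝ ∞ b) : ContDiff ℝ ∞ (fun x => pt (a x) (b x)) := by
  simp only [pt_eq]
  fun_prop

@[fun_prop]
theorem continuous_pt_comp {F : Type*} [TopologicalSpace F] {a b : F → ℝ}
    (ha : Continuous a) (hb : Continuous b) : Continuous (fun x => pt (a x) (b x)) := by
  simp only [pt_eq]
  fun_prop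

theorem hasDerivAt_comp_pt {X : E2 → ℝ} (hX : ContDiff ℝ ∞ X) {a b : ℝ → ℝ} {a' b' s : ℝ}
    (ha : HasDerivAt a a' s) (hb : HasDerivAt b b' s) :
    HasDerivAt (fun s => X (pt (a s) (b s)))
      (a' * pds 0 X (pt (a s) (b s)) + b' * pds 1 X (pt (a s) (b s))) s := by
  have h1 : HasDerivAt (fun s => pt (a s) (b s)) (pt a' b') s := by
    simp only [pt_eq]
    exact (ha.smul_const _).add (hb.smul_const _)
  have h2 := (hX.differentiableAt_top (pt (a s) (b s))).hasFDerivAt.comp_hasDerivAt s h1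
  refine h2.congr_deriv ?_
  rw [pt_eq a' b', map_add, map_smul, map_smul]
  simp [pds]

theorem hasDerivAt_comp_pt_Eu {l : ℕ} {X : E2 → Eu l} (hX : ContDiff ℝ ∞ X) {a b : ℝ → ℝ}
    {a' b' s : ℝ} (ha : HasDerivAt a a' s) (hb : HasDerivAt b b' s) :
    HasDerivAt (fun s => X (pt (a s) (b s)))
      (a' • pd 0 X (pt (a s) (b s)) + b' • pd 1 X (pt (a s) (b s))) s := by
  have h1 : HasDerivAt (fun s => pt (a s) (b s)) (pt a' b') s := by
    simp only [pt_eq]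
    exact (ha.smul_const _).add (hb.smul_const _)
  have h2 := (hX.differentiableAt_top (pt (a s) (b s))).hasFDerivAt.comp_hasDerivAt s h1
  refine h2.congr_deriv ?_
  rw [pt_eq a' b', map_add, map_smul, map_smul]
  simp [pd]

/-- The integral of `g` over the circle of radius `t` with respect to the angle. -/
def circ (g : E2 → ℝ) (t : ℝ) : ℝ :=
  ∫ θ in (-Real.pi)..Real.pi, g (pt (t * Real.cos θ) (t * Real.sin θ))

theorem continuous_circ {g : E2 → ℝ} (hg : Continuous g) : Continuous (circ g) := by
  unfold circ
  exact intervalIntegral.continuous_parametric_intervalIntegral_of_continuous' (by fun_prop) _ _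

theorem circ_integrable {g : E2 → ℝ} (hg : Continuous g) (t a b : ℝ) :
    IntervalIntegrable (fun θ => g (pt (t * Real.cos θ) (t * Real.sin θ))) volume a b :=
  Continuous.intervalIntegrable (by fun_prop) _ _

theorem integral_div_annulus {X Y : E2 → ℝ} (hX : ContDiff ℝ ∞ X) (hY : ContDiff ℝ ∞ Y)
    (a b : ℝ) :
    ∫ t in a..b, t * circ (fun x => pds 0 X x + pds 1 Y x) t
      = circ (fun x => X x * x 0 + Y x * x 1) b - circ (fun x => X x * x 0 + Y x * x 1) a := by
  set γ : ℝ × ℝ → E2 := fun p => pt (p.1 * Real.cos p.2) (p.1 * Real.sin p.2) with hγ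
  have hγs : ContDiff ℝ ∞ γ := contDiff_pt_comp (by fun_prop) (by fun_prop)
  set F : ℝ × ℝ → ℝ := fun p => X (γ p) * (p.1 * Real.cos p.2) + Y (γ p) * (p.1 * Real.sin p.2)
    with hF
  set G : ℝ × ℝ → ℝ := fun p => Y (γ p) * Real.cos p.2 - X (γ p) * Real.sin p.2 with hG
  have hXγ : ContDiff ℝ ∞ (fun p => X (γ p)) := hX.comp hγs
  have hYγ : ContDiff ℝ ∞ (fun p => Y (γ p)) := hY.comp hγs
  have hFs : ContDiff ℝ ∞ F := by fun_prop
  have hGs : ContDiff ℝ ∞ G := by fun_prop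
  have hF' : ∀ p : ℝ × ℝ, fderiv ℝ F p (1, 0) = X (γ p) * Real.cos p.2 + Y (γ p) * Real.sin p.2
      + p.1 * (Real.cos p.2 * (Real.cos p.2 * pds 0 X (γ p) + Real.sin p.2 * pds 1 X (γ p))
        + Real.sin p.2 * (Real.cos p.2 * pds 0 Y (γ p) + Real.sin p.2 * pds 1 Y (γ p))) := by
    rintro ⟨t, θ⟩
    have h1 : HasDerivAt (fun s : ℝ => ((s, θ) : ℝ × ℝ)) (1, 0) t :=
      (hasDerivAt_id t).prodMk (hasDerivAt_const t θ)
    have h2 := (hFs.differentiableAt_top (t, θ)).hasFDerivAt.comp_hasDerivAt t h1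
    have ha : HasDerivAt (fun s : ℝ => s * Real.cos θ) (Real.cos θ) t := hasDerivAt_mul_const _
    have hb : HasDerivAt (fun s : ℝ => s * Real.sin θ) (Real.sin θ) t := hasDerivAt_mul_const _
    have h3 := ((hasDerivAt_comp_pt hX ha hb).mul ha).add ((hasDerivAt_comp_pt hY ha hb).mul hb)
    rw [h2.unique h3]
    simp only [hγ]
    ring
  have hG' : ∀ p : ℝ × ℝ, fderiv ℝ G p (0, 1) = - X (γ p) * Real.cos p.2 - Y (γ p) * Real.sin p.2
      + p.1 * (Real.cos p.2 * (- Real.sin p.2 * pds 0 Y (γ p) + Real.cos p.2 * pds 1 Y (γ p))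
        - Real.sin p.2 * (- Real.sin p.2 * pds 0 X (γ p) + Real.cos p.2 * pds 1 X (γ p))) := by
    rintro ⟨t, θ⟩
    have h1 : HasDerivAt (fun s : ℝ => ((t, s) : ℝ × ℝ)) (0, 1) θ :=
      (hasDerivAt_const θ t).prodMk (hasDerivAt_id θ)
    have h2 := (hGs.differentiableAt_top (t, θ)).hasFDerivAt.comp_hasDerivAt θ h1
    have hc := Real.hasDerivAt_cos θ
    have hs := Real.hasDerivAt_sin θ
    have ha := hc.const_mul t
    have hb := hs.const_mul t
    have h3 := ((hasDerivAt_comp_pt hY ha hb).mul hc).sub ((hasDerivAt_comp_pt hX ha hb).mul hs)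
    rw [h2.unique h3]
    simp only [hγ]
    ring
  have hcont : Continuous (fun x => fderiv ℝ F x (1, 0) + fderiv ℝ G x (0, 1)) := by
    have e1 : Continuous (fderiv ℝ F) := hFs.continuous_fderiv (by simp)
    have e2 : Continuous (fderiv ℝ G) := hGs.continuous_fderiv (by simp)
    fun_prop
  have key := integral2_divergence_prod_of_hasFDerivAt F G (fderiv ℝ F) (fderiv ℝ G) a (-Real.pi)
    b Real.pi hFs.continuous.continuousOn hGs.continuous.continuousOn
    (fun x _ => (hFs.differentiableAt_top x).hasFDerivAt)
    (fun x _ => (hGs.differentiableAt_top x).hasFDerivAt)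
    (hcont.continuousOn.integrableOn_compact (isCompact_uIcc.prod isCompact_uIcc))
  have hper : ∀ t, G (t, Real.pi) = G (t, -Real.pi) := by
    intro t
    simp [hG, hγ]
  simp only [hper, sub_self, zero_add] at key
  calc ∫ t in a..b, t * circ (fun x => pds 0 X x + pds 1 Y x) t
      = ∫ t in a..b, ∫ θ in (-Real.pi)..Real.pi,
          fderiv ℝ F (t, θ) (1, 0) + fderiv ℝ G (t, θ) (0, 1) := by
        congr 1
        funext t
        rw [circ, ← intervalIntegral.integral_const_mul]
        congr 1
        funext θ
        rw [hF', hG']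
        simp only [hγ]
        linear_combination (-t) * (pds 0 X (γ (t, θ)) + pds 1 Y (γ (t, θ)))
          * Real.sin_sq_add_cos_sq θ
    _ = _ := key

end Polar

section PolarIntegral

theorem integral_E2_eq (f : E2 → ℝ) : ∫ x, f x = ∫ p : ℝ × ℝ, f (pt p.1 p.2) := by
  have h1 := (EuclideanSpace.volume_preserving_symm_measurableEquiv_toLp (Fin 2)).symm
  have h2 := (volume_preserving_finTwoArrow ℝ).symm
  have h3 := h1.comp h2
  rw [← h3.integral_comp ((MeasurableEquiv.measurableEmbedding _).comp
    (MeasurableEquiv.measurableEmbedding _))]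
  rfl

theorem setIntegral_ann {g : E2 → ℝ} (hg : Continuous g) {a b : ℝ} (ha : 0 ≤ a) (hab : a ≤ b) :
    ∫ x in ann a b, g x = ∫ t in a..b, t * circ g t := by
  have hm : MeasurableSet (ann a b) := by
    have : ann a b = (fun x : E2 => ‖x‖) ⁻¹' Set.Ioo a b := rfl
    rw [this]
    exact continuous_norm.measurable measurableSet_Ioo
  rw [← integral_indicator hm, integral_E2_eq, ← integral_comp_polarCoord_symm,
    polarCoord_target]
  have hmem : ∀ p ∈ Set.Ioi (0 : ℝ) ×ˢ Set.Ioo (-Real.pi) Real.pi,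
      p.1 • (ann a b).indicator g (pt (polarCoord.symm p).1 (polarCoord.symm p).2)
        = (Set.Ioo a b ×ˢ Set.Ioo (-Real.pi) Real.pi).indicator
          (fun p => p.1 * g (pt (p.1 * Real.cos p.2) (p.1 * Real.sin p.2))) p := by
    rintro ⟨t, θ⟩ ⟨ht, hθ⟩
    have ht' : (0 : ℝ) < t := ht
    simp only [polarCoord_symm_apply]
    by_cases h : t ∈ Set.Ioo a b
    · rw [Set.indicator_of_mem (by simpa [ann, norm_pt_polar ht'.le] using h),
        Set.indicator_of_mem (show (t, θ) ∈ Set.Ioo a b ×ˢ Set.Ioo (-Real.pi) Real.pi from ⟨h, hθ⟩)]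
      rfl
    · rw [Set.indicator_of_notMem (by simpa [ann, norm_pt_polar ht'.le] using h),
        Set.indicator_of_notMem (fun hc => h hc.1), smul_zero]
  rw [setIntegral_congr_fun (measurableSet_Ioi.prod measurableSet_Ioo) hmem,
    setIntegral_indicator (measurableSet_Ioo.prod measurableSet_Ioo),
    Set.inter_eq_right.2 (Set.prod_mono
      (show Set.Ioo a b ⊆ Set.Ioi 0 from fun t ht => ha.trans_lt ht.1) subset_rfl)]
  have hc : Continuous (fun p : ℝ × ℝ => p.1 * g (pt (p.1 * Real.cos p.2) (p.1 * Real.sin p.2))) := by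
    fun_prop
  rw [Measure.volume_eq_prod, setIntegral_prod]
  · rw [intervalIntegral.integral_of_le hab, integral_Ioc_eq_integral_Ioo]
    refine setIntegral_congr_fun measurableSet_Ioo fun t _ => ?_
    simp only
    rw [integral_const_mul, circ, intervalIntegral.integral_of_le (by linarith [Real.pi_pos]),
      integral_Ioc_eq_integral_Ioo]
  · exact (hc.continuousOn.integrableOn_compact (isCompact_Icc.prod isCompact_Icc)).mono_set
      (Set.prod_mono Set.Ioo_subset_Icc_self Set.Ioo_subset_Icc_self)

theorem setIntegral_ball {g : E2 → ℝ} (hg : Continuous g) {b : ℝ} (hb : 0 ≤ b) :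
    ∫ x in ball (0 : E2) b, g x = ∫ t in (0 : ℝ)..b, t * circ g t := by
  rw [← setIntegral_ann hg le_rfl hb]
  refine setIntegral_congr_set ?_
  have : ann 0 b = ball (0 : E2) b \ {0} := by
    ext x
    simp [ann, and_comm]
  rw [this]
  exact (sdiff_null_ae_eq_self (measure_singleton 0)).symm

end PolarIntegral

section Wirtinger

variable {l : ℕ}

theorem sq_integral_le {f : ℝ → ℝ} (hf : Continuous f) {a b : ℝ} (hab : a < b) :
    (∫ θ in a..b, f θ) ^ 2 ≤ (b - a) * ∫ θ in a..b, f θ ^ 2 := by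
  set M := ∫ θ in a..b, f θ
  set m := M / (b - a)
  have hba : 0 < b - a := sub_pos.2 hab
  have h0 : 0 ≤ ∫ θ in a..b, (f θ - m) ^ 2 :=
    intervalIntegral.integral_nonneg hab.le fun _ _ => sq_nonneg _
  have h1 : ∫ θ in a..b, (f θ - m) ^ 2
      = (∫ θ in a..b, f θ ^ 2) - 2 * m * M + (b - a) * m ^ 2 := by
    have : ∀ θ, (f θ - m) ^ 2 = (f θ ^ 2 - (2 * m) * f θ) + m ^ 2 := fun θ => by ring
    simp only [this]
    rw [intervalIntegral.integral_add, intervalIntegral.integral_sub,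
      intervalIntegral.integral_const_mul, intervalIntegral.integral_const, smul_eq_mul]
    all_goals exact Continuous.intervalIntegrable (by fun_prop) _ _
  have hm : m * (b - a) = M := div_mul_cancel₀ _ hba.ne'
  rw [h1] at h0
  nlinarith [mul_nonneg h0 hba.le]

/-- A Poincaré–Wirtinger inequality on the circle, with a nonoptimal constant. -/
theorem wirtinger {g g' : ℝ → Eu l} (hg : ∀ θ, HasDerivAt g (g' θ) θ) (hg' : Continuous g')
    (h0 : ∫ θ in (-Real.pi)..Real.pi, g θ = 0) :
    ∫ θ in (-Real.pi)..Real.pi, ‖g θ‖ ^ 2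
      ≤ 4 * Real.pi ^ 2 * ∫ θ in (-Real.pi)..Real.pi, ‖g' θ‖ ^ 2 := by
  have hπ := Real.pi_pos
  have hle : -Real.pi ≤ Real.pi := by linarith
  have hgc : Continuous g := continuous_iff_continuousAt.2 fun θ => (hg θ).continuousAt
  set M := ∫ θ in (-Real.pi)..Real.pi, ‖g' θ‖ with hM
  have hM0 : 0 ≤ M := intervalIntegral.integral_nonneg hle fun _ _ => norm_nonneg _
  have hosc : ∀ θ ∈ Set.Icc (-Real.pi) Real.pi, ∀ α ∈ Set.Icc (-Real.pi) Real.pi,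
      ‖g θ - g α‖ ≤ M := by
    intro θ hθ α hα
    rw [← intervalIntegral.integral_eq_sub_of_hasDerivAt (fun x _ => hg x)
      (hg'.intervalIntegrable _ _)]
    refine intervalIntegral.norm_integral_le_integral_norm_uIoc.trans ?_
    rw [hM, intervalIntegral.integral_of_le hle]
    refine setIntegral_mono_set ?_ (Eventually.of_forall fun _ => norm_nonneg _) ?_
    · exact (hg'.norm.intervalIntegrable _ _).1
    · exact LE.le.eventuallyLE <| Set.Ioc_subset_Ioc (le_min hα.1 hθ.1) (max_le hα.2 hθ.2)
  have hsup : ∀ θ ∈ Set.Icc (-Real.pi) Real.pi, ‖g θ‖ ≤ M := by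
    intro θ hθ
    have e : (2 * Real.pi) • g θ = ∫ α in (-Real.pi)..Real.pi, (g θ - g α) := by
      rw [intervalIntegral.integral_sub (by simp) (hgc.intervalIntegrable _ _), h0,
        intervalIntegral.integral_const, sub_zero]
      congr 1
      ring
    have h2 : ‖∫ α in (-Real.pi)..Real.pi, (g θ - g α)‖ ≤ M * |Real.pi - -Real.pi| := by
      refine intervalIntegral.norm_integral_le_of_norm_le_const fun α hα => ?_
      rw [Set.uIoc_of_le hle] at hα
      exact hosc θ hθ α ⟨hα.1.le, hα.2⟩
    rw [← e, norm_smul, Real.norm_of_nonneg (by positivity), abs_of_nonneg (by linarith)] at h2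
    nlinarith
  have h3 : ∫ θ in (-Real.pi)..Real.pi, ‖g θ‖ ^ 2 ≤ ∫ θ in (-Real.pi)..Real.pi, M ^ 2 := by
    refine intervalIntegral.integral_mono_on hle ?_ (by simp) fun θ hθ => ?_
    · exact Continuous.intervalIntegrable (by fun_prop) _ _
    · exact pow_le_pow_left₀ (norm_nonneg _) (hsup θ hθ) 2
  have h4 := sq_integral_le hg'.norm (show -Real.pi < Real.pi by linarith)
  rw [intervalIntegral.integral_const, smul_eq_mul] at h3
  nlinarith

theorem circ_rot_le {u : E2 → Eu l} (hu : ContDiff ℝ ∞ u) (t : ℝ) :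
    circ (fun x => ‖rot u x‖ ^ 2) t ≤ 4 * Real.pi ^ 2 * circ (fun x => ‖rot (rot u) x‖ ^ 2) t := by
  have key : ∀ {v : E2 → Eu l}, ContDiff ℝ ∞ v → ∀ θ,
      HasDerivAt (fun θ => v (pt (t * Real.cos θ) (t * Real.sin θ)))
        (rot v (pt (t * Real.cos θ) (t * Real.sin θ))) θ := by
    intro v hv θ
    refine (hasDerivAt_comp_pt_Eu hv ((Real.hasDerivAt_cos θ).const_mul t)
      ((Real.hasDerivAt_sin θ).const_mul t)).congr_deriv ?_
    simp only [rot, pt_zero, pt_one]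
    module
  have hr := contDiff_rot hu
  have hrr := contDiff_rot hr
  have c1 := hr.continuous
  have c2 := hrr.continuous
  refine wirtinger (key hr) (by fun_prop) ?_
  rw [intervalIntegral.integral_eq_sub_of_hasDerivAt (fun θ _ => key hu θ)
    (Continuous.intervalIntegrable (by fun_prop) _ _)]
  simp

end Wirtinger

section Bounds

variable {l : ℕ}

/-- The scale-invariant bounds `|∇^t u(x)| ≤ s |x|^{-t}`, `t = 1, 2, 3`, for partial derivatives. -/
structure ScaledBound (s : ℝ) (u : E2 → Eu l) (x : E2) : Prop where
  first : ∀ α, ‖pd α u x‖ ≤ s / ‖x‖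
  second : ∀ α β, ‖pd α (pd β u) x‖ ≤ s / ‖x‖ ^ 2
  third : ∀ α β γ, ‖pd α (pd β (pd γ u)) x‖ ≤ s / ‖x‖ ^ 3

theorem abs_coord_le (x : E2) (α : Fin 2) : |x α| ≤ ‖x‖ := PiLp.norm_apply_le x α

theorem norm_rot_le {v : E2 → Eu l} {x : E2} {B : ℝ} (h : ∀ α, ‖pd α v x‖ ≤ B) :
    ‖rot v x‖ ≤ 2 * ‖x‖ * B := by
  refine (norm_sub_le _ _).trans ?_
  rw [norm_smul, norm_smul]
  have h1 := mul_le_mul (abs_coord_le x 0) (h 1) (norm_nonneg _) (norm_nonneg _)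
  have h2 := mul_le_mul (abs_coord_le x 1) (h 0) (norm_nonneg _) (norm_nonneg _)
  simp only [Real.norm_eq_abs]
  linarith

theorem norm_pd_rot_le {v : E2 → Eu l} (hv : ContDiff ℝ ∞ v) {x : E2} {B₁ B₂ : ℝ}
    (h1 : ∀ α, ‖pd α v x‖ ≤ B₁) (h2 : ∀ α β, ‖pd α (pd β v) x‖ ≤ B₂) (α : Fin 2) :
    ‖pd α (rot v) x‖ ≤ B₁ + 2 * ‖x‖ * B₂ := by
  fin_cases α
  · change ‖pd 0 (rot v) x‖ ≤ _
    rw [pd_zero_rot hv]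
    exact (norm_add_le _ _).trans (add_le_add (h1 1) (norm_rot_le fun β => h2 β 0))
  · change ‖pd 1 (rot v) x‖ ≤ _
    rw [pd_one_rot hv]
    refine (norm_sub_le _ _).trans ?_
    rw [add_comm]
    exact add_le_add (h1 0) (norm_rot_le fun β => h2 β 1)

theorem norm_pd_pd_rot_le {v : E2 → Eu l} (hv : ContDiff ℝ ∞ v) {x : E2} {B₂ B₃ : ℝ}
    (h2 : ∀ α β, ‖pd α (pd β v) x‖ ≤ B₂) (h3 : ∀ α β γ, ‖pd α (pd β (pd γ v)) x‖ ≤ B₃)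
    (α β : Fin 2) :
    ‖pd α (pd β (rot v)) x‖ ≤ B₂ + (B₂ + 2 * ‖x‖ * B₃) := by
  have h := fun γ => contDiff_pd hv γ
  have hr := fun γ => contDiff_rot (h γ)
  have hb : ∀ γ, ‖pd α (rot (pd γ v)) x‖ ≤ B₂ + 2 * ‖x‖ * B₃ := fun γ =>
    norm_pd_rot_le (h γ) (fun κ => h2 κ γ) (fun κ κ' => h3 κ κ' γ) α
  fin_cases β
  · change ‖pd α (pd 0 (rot v)) x‖ ≤ _
    rw [pd_zero_rot hv, pd_add (h 1) (hr 0)]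
    exact (norm_add_le _ _).trans (add_le_add (h2 α 1) (hb 0))
  · change ‖pd α (pd 1 (rot v)) x‖ ≤ _
    rw [pd_one_rot hv, pd_sub (hr 1) (h 0)]
    refine (norm_sub_le _ _).trans ?_
    rw [add_comm]
    exact add_le_add (h2 α 0) (hb 1)

theorem abs_inner_le {a b : Eu l} {A B : ℝ} (ha : ‖a‖ ≤ A) (hb : ‖b‖ ≤ B) : |⟪a, b⟫| ≤ A * B :=
  (abs_real_inner_le_norm a b).trans
    (mul_le_mul ha hb (norm_nonneg _) ((norm_nonneg _).trans ha))

theorem norm_sq_eq (x : E2) : ‖x‖ ^ 2 = x 0 ^ 2 + x 1 ^ 2 := by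
  rw [EuclideanSpace.norm_sq_eq]
  simp [Fin.sum_univ_two]

theorem norm_rot_sq_le (v : E2 → Eu l) (x : E2) : ‖rot v x‖ ^ 2 ≤ ‖x‖ ^ 2 * gradSq v x := by
  have h : ‖rot v x‖ ^ 2 + ‖x 0 • pd 0 v x + x 1 • pd 1 v x‖ ^ 2 = ‖x‖ ^ 2 * gradSq v x := by
    rw [norm_sq_eq, gradSq, rot]
    simp only [← real_inner_self_eq_norm_sq, inner_add_left, inner_add_right, inner_sub_left,
      inner_sub_right, real_inner_smul_left, real_inner_smul_right,
      real_inner_comm (pd 1 v x) (pd 0 v x)]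
    ring
  nlinarith [sq_nonneg ‖x 0 • pd 0 v x + x 1 • pd 1 v x‖]

section

variable {u : E2 → Eu l} (hu : ContDiff ℝ ∞ u) {s : ℝ} {x : E2} (hx : 0 < ‖x‖)
  (hb : ScaledBound s u x)

include hb

theorem gradSq_le_of_scaledBound : gradSq u x ≤ 2 * s ^ 2 / ‖x‖ ^ 2 := by
  have h := fun α => pow_le_pow_left₀ (norm_nonneg _) (hb.first α) 2
  have e : 2 * s ^ 2 / ‖x‖ ^ 2 = (s / ‖x‖) ^ 2 + (s / ‖x‖) ^ 2 := by ring
  rw [gradSq, e]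
  exact add_le_add (h 0) (h 1)

theorem norm_lap_le_of_scaledBound : ‖lap u x‖ ≤ 2 * s / ‖x‖ ^ 2 := by
  refine (norm_add_le _ _).trans ?_
  have e : 2 * s / ‖x‖ ^ 2 = s / ‖x‖ ^ 2 + s / ‖x‖ ^ 2 := by ring
  rw [e]
  exact add_le_add (hb.second 0 0) (hb.second 1 1)

theorem norm_lap_sq_le_of_scaledBound : ‖lap u x‖ ^ 2 ≤ 4 * s ^ 2 / ‖x‖ ^ 4 := by
  refine (pow_le_pow_left₀ (norm_nonneg _) (norm_lap_le_of_scaledBound hb) 2).trans_eq ?_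
  ring

include hu in
theorem norm_pd_lap_le (α : Fin 2) : ‖pd α (lap u) x‖ ≤ 2 * s / ‖x‖ ^ 3 := by
  have e : pd α (lap u) x = pd α (pd 0 (pd 0 u)) x + pd α (pd 1 (pd 1 u)) x :=
    pd_add (contDiff_pd (contDiff_pd hu 0) 0) (contDiff_pd (contDiff_pd hu 1) 1) α x
  rw [e]
  refine (norm_add_le _ _).trans ?_
  have e : 2 * s / ‖x‖ ^ 3 = s / ‖x‖ ^ 3 + s / ‖x‖ ^ 3 := by ring
  rw [e]
  exact add_le_add (hb.third α 0 0) (hb.third α 1 1)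

include hx

theorem norm_rot_le_of_scaledBound : ‖rot u x‖ ≤ 2 * s := by
  refine (norm_rot_le hb.first).trans_eq ?_
  field_simp

include hu

theorem norm_pd_rot_le_of_scaledBound (α : Fin 2) : ‖pd α (rot u) x‖ ≤ 3 * s / ‖x‖ := by
  refine (norm_pd_rot_le hu hb.first hb.second α).trans_eq ?_
  field_simp
  ring

theorem norm_rot_rot_le_of_scaledBound : ‖rot (rot u) x‖ ≤ 6 * s := by
  refine (norm_rot_le (norm_pd_rot_le_of_scaledBound hu hx hb)).trans_eq ?_
  field_simp
  ring

theorem norm_pd_rot_rot_le_of_scaledBound (α : Fin 2) :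
    ‖pd α (rot (rot u)) x‖ ≤ 11 * s / ‖x‖ := by
  refine (norm_pd_rot_le (contDiff_rot hu) (norm_pd_rot_le_of_scaledBound hu hx hb)
    (norm_pd_pd_rot_le hu hb.second hb.third) α).trans_eq ?_
  field_simp
  ring

theorem norm_rotTest_le (hs0 : 0 ≤ s) (hs : s ≤ 1) (h1 : ‖u x‖ = 1) :
    ‖rotTest u x‖ ≤ 10 * s := by
  refine (norm_add_le _ _).trans ?_
  have a := norm_rot_rot_le_of_scaledBound hu hx hb
  have b := norm_rot_le_of_scaledBound hx hb
  have c := abs_inner_le b b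
  rw [norm_smul, h1, mul_one, Real.norm_eq_abs]
  nlinarith

theorem norm_pd_rotTest_le (hs0 : 0 ≤ s) (hs : s ≤ 1) (h1 : ‖u x‖ = 1) (α : Fin 2) :
    ‖pd α (rotTest u) x‖ ≤ 27 * s / ‖x‖ := by
  have hr := contDiff_rot hu
  have hrr := contDiff_rot hr
  have e : pd α (rotTest u) x = pd α (rot (rot u)) x
      + ((⟪pd α (rot u) x, rot u x⟫ + ⟪rot u x, pd α (rot u) x⟫) • u x
        + ⟪rot u x, rot u x⟫ • pd α u x) := by
    unfold rotTest
    rw [pd_add hrr (by fun_prop), pd_smul (by fun_prop) hu, pds_inner hr hr]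
  have a := norm_pd_rot_rot_le_of_scaledBound hu hx hb α
  have b := norm_rot_le_of_scaledBound hx hb
  have b' := norm_pd_rot_le_of_scaledBound hu hx hb α
  have c := abs_inner_le b b
  have c1 := abs_inner_le b b'
  have c2 := abs_inner_le b' b
  rw [e]
  refine (norm_add_le _ _).trans ((add_le_add_right (norm_add_le _ _) _).trans ?_)
  rw [norm_smul, norm_smul, h1, mul_one, Real.norm_eq_abs, Real.norm_eq_abs]
  have d1 := abs_add_le ⟪pd α (rot u) x, rot u x⟫ ⟪rot u x, pd α (rot u) x⟫
  have d2 := mul_le_mul c (hb.first α) (norm_nonneg _) (by positivity)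
  have hs2 : s ^ 2 ≤ s := by nlinarith
  have hs3 : s ^ 3 ≤ s := by nlinarith
  have t1 : s ^ 2 / ‖x‖ ≤ s / ‖x‖ := by gcongr
  have t2 : s ^ 3 / ‖x‖ ≤ s / ‖x‖ := by gcongr
  have e1 : 2 * s * (3 * s / ‖x‖) = 6 * (s ^ 2 / ‖x‖) := by ring
  have e2 : 3 * s / ‖x‖ * (2 * s) = 6 * (s ^ 2 / ‖x‖) := by ring
  have e3 : 2 * s * (2 * s) * (s / ‖x‖) = 4 * (s ^ 3 / ‖x‖) := by ring
  have e4 : 27 * s / ‖x‖ = 27 * (s / ‖x‖) := by ring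
  have e5 : 11 * s / ‖x‖ = 11 * (s / ‖x‖) := by ring
  rw [e4]
  rw [e5] at a
  rw [e1] at c1
  rw [e2] at c2
  rw [e3] at d2
  linarith

theorem abs_inner_pd_lap_pd_rotTest_le (hs0 : 0 ≤ s) (hs : s ≤ 1) (h1 : ‖u x‖ = 1) :
    |⟪pd 0 (lap u) x, pd 0 (rotTest u) x⟫ + ⟪pd 1 (lap u) x, pd 1 (rotTest u) x⟫|
      ≤ 108 * s ^ 2 / ‖x‖ ^ 4 := by
  have h := fun α => abs_inner_le (norm_pd_lap_le hu hb α)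
    (norm_pd_rotTest_le hu hx hb hs0 hs h1 α)
  refine (abs_add_le _ _).trans ((add_le_add (h 0) (h 1)).trans_eq ?_)
  field_simp
  ring

theorem abs_rotField_le {ε : ℝ} (hε : 0 ≤ ε) (hs0 : 0 ≤ s) (hs : s ≤ 1) (h1 : ‖u x‖ = 1) :
    |rotField ε u 0 x * x 0 + rotField ε u 1 x * x 1| ≤ 12 * s ^ 2 + 40 * ε * s ^ 2 / ‖x‖ ^ 2 := by
  have e : rotField ε u 0 x * x 0 + rotField ε u 1 x * x 1
      = (⟪pd 0 (rot u) x, rot u x⟫ + ε * ⟪pd 0 (lap u) x, rotTest u x⟫) * x 0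
        + (⟪pd 1 (rot u) x, rot u x⟫ + ε * ⟪pd 1 (lap u) x, rotTest u x⟫) * x 1 := by
    simp only [rotField, reduceIte, one_ne_zero, Fin.isValue]
    ring
  have h : ∀ α, |(⟪pd α (rot u) x, rot u x⟫ + ε * ⟪pd α (lap u) x, rotTest u x⟫) * x α|
      ≤ 6 * s ^ 2 + 20 * ε * s ^ 2 / ‖x‖ ^ 2 := by
    intro α
    have a := abs_inner_le (norm_pd_rot_le_of_scaledBound hu hx hb α)
      (norm_rot_le_of_scaledBound hx hb)
    have b := abs_inner_le (norm_pd_lap_le hu hb α) (norm_rotTest_le hu hx hb hs0 hs h1)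
    have c : |⟪pd α (rot u) x, rot u x⟫ + ε * ⟪pd α (lap u) x, rotTest u x⟫|
        ≤ 3 * s / ‖x‖ * (2 * s) + ε * (2 * s / ‖x‖ ^ 3 * (10 * s)) := by
      refine (abs_add_le _ _).trans (add_le_add a ?_)
      rw [abs_mul, abs_of_nonneg hε]
      exact mul_le_mul_of_nonneg_left b hε
    rw [abs_mul]
    refine (mul_le_mul c (abs_coord_le x α) (abs_nonneg _) (by positivity)).trans_eq ?_
    field_simp
    ring
  rw [e]
  refine (abs_add_le _ _).trans ((add_le_add (h 0) (h 1)).trans_eq ?_)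
  ring

end

/-- The biharmonic part of the radial stress, `S²(x, x)`. -/
def bistress (u : E2 → Eu l) (x : E2) : ℝ :=
  ((1 / 2) * ⟪lap u x, lap u x⟫
      + (⟪pd 0 u x, pd 0 (lap u) x⟫ + ⟪pd 1 u x, pd 1 (lap u) x⟫)) * (x 0 ^ 2 + x 1 ^ 2)
    - 2 * ⟪x 0 • pd 0 u x + x 1 • pd 1 u x, x 0 • pd 0 (lap u) x + x 1 • pd 1 (lap u) x⟫

theorem contDiff_bistress {u : E2 → Eu l} (hu : ContDiff ℝ ∞ u) : ContDiff ℝ ∞ (bistress u) := by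
  have h0 := contDiff_pd hu 0
  have h1 := contDiff_pd hu 1
  have hw := contDiff_lap hu
  have w0 := contDiff_pd hw 0
  have w1 := contDiff_pd hw 1
  unfold bistress
  fun_prop

theorem stressField_radial (u : E2 → Eu l) (ε : ℝ) (x : E2) :
    stressField ε u 0 x * x 0 + stressField ε u 1 x * x 1
      = ‖rot u x‖ ^ 2 - (1 / 2) * (‖x‖ ^ 2 * gradSq u x) - ε * bistress u x := by
  rw [norm_sq_eq, gradSq, rot]
  simp only [stressField, bistress, ← real_inner_self_eq_norm_sq, inner_add_left, inner_add_right,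
    inner_sub_left, inner_sub_right, real_inner_smul_left, real_inner_smul_right,
    real_inner_comm (pd 1 u x) (pd 0 u x)]
  ring

theorem abs_bistress_le {u : E2 → Eu l} (hu : ContDiff ℝ ∞ u) {s : ℝ} {x : E2} (hx : 0 < ‖x‖)
    (hb : ScaledBound s u x) : |bistress u x| ≤ 22 * s ^ 2 / ‖x‖ ^ 2 := by
  have a := norm_lap_le_of_scaledBound hb
  have a2 := abs_inner_le a a
  have b := fun α => abs_inner_le (hb.first α) (norm_pd_lap_le hu hb α)
  have radial : ∀ (v : E2 → Eu l) (B : ℝ), (∀ α, ‖pd α v x‖ ≤ B) →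
      ‖x 0 • pd 0 v x + x 1 • pd 1 v x‖ ≤ 2 * ‖x‖ * B := by
    intro v B h
    refine (norm_add_le _ _).trans ?_
    rw [norm_smul, norm_smul]
    have h1 := mul_le_mul (abs_coord_le x 0) (h 0) (norm_nonneg _) (norm_nonneg _)
    have h2 := mul_le_mul (abs_coord_le x 1) (h 1) (norm_nonneg _) (norm_nonneg _)
    simp only [Real.norm_eq_abs]
    linarith
  have c := abs_inner_le (radial u _ hb.first) (radial (lap u) _ (norm_pd_lap_le hu hb))
  rw [bistress, ← norm_sq_eq]
  refine (abs_sub _ _).trans ?_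
  rw [abs_mul, abs_mul, abs_of_nonneg (sq_nonneg ‖x‖), abs_two]
  have d : |(1 / 2) * ⟪lap u x, lap u x⟫
      + (⟪pd 0 u x, pd 0 (lap u) x⟫ + ⟪pd 1 u x, pd 1 (lap u) x⟫)|
      ≤ 1 / 2 * (2 * s / ‖x‖ ^ 2 * (2 * s / ‖x‖ ^ 2))
        + (s / ‖x‖ * (2 * s / ‖x‖ ^ 3) + s / ‖x‖ * (2 * s / ‖x‖ ^ 3)) := by
    refine (abs_add_le _ _).trans (add_le_add ?_ ((abs_add_le _ _).trans (add_le_add (b 0) (b 1))))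
    rw [abs_mul, abs_of_pos (by norm_num : (0 : ℝ) < 1 / 2)]
    linarith
  refine (add_le_add (mul_le_mul_of_nonneg_right d (sq_nonneg _))
    (mul_le_mul_of_nonneg_left c zero_le_two)).trans_eq ?_
  field_simp
  ring

end Bounds

section Neck

variable {l : ℕ}

theorem circ_mono {f g : E2 → ℝ} (hf : Continuous f) (hg : Continuous g) {t : ℝ} (ht : 0 ≤ t)
    (h : ∀ x, ‖x‖ = t → f x ≤ g x) : circ f t ≤ circ g t :=
  intervalIntegral.integral_mono_on (by linarith [Real.pi_pos]) (circ_integrable hf t _ _)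
    (circ_integrable hg t _ _) fun θ _ => h _ (norm_pt_polar ht θ)

theorem circ_congr {f g : E2 → ℝ} {t : ℝ} (ht : 0 ≤ t) (h : ∀ x, ‖x‖ = t → f x = g x) :
    circ f t = circ g t :=
  intervalIntegral.integral_congr fun θ _ => h _ (norm_pt_polar ht θ)

theorem circ_nonneg {f : E2 → ℝ} {t : ℝ} (h : ∀ x, 0 ≤ f x) : 0 ≤ circ f t :=
  intervalIntegral.integral_nonneg (by linarith [Real.pi_pos]) fun _ _ => h _

theorem abs_circ_le {f : E2 → ℝ} {t B : ℝ} (ht : 0 ≤ t) (h : ∀ x, ‖x‖ = t → |f x| ≤ B) :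
    |circ f t| ≤ 2 * Real.pi * B := by
  have := intervalIntegral.norm_integral_le_of_norm_le_const (a := -Real.pi) (b := Real.pi)
    (f := fun θ => f (pt (t * Real.cos θ) (t * Real.sin θ))) (C := B)
    fun θ _ => h _ (norm_pt_polar ht θ)
  rw [abs_of_pos (by linarith [Real.pi_pos] : 0 < Real.pi - -Real.pi)] at this
  exact this.trans_eq (by ring)

theorem circ_add {f g : E2 → ℝ} (hf : Continuous f) (hg : Continuous g) (t : ℝ) :
    circ (fun x => f x + g x) t = circ f t + circ g t :=
  intervalIntegral.integral_add (circ_integrable hf t _ _) (circ_integrable hg t _ _)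

theorem circ_sub {f g : E2 → ℝ} (hf : Continuous f) (hg : Continuous g) (t : ℝ) :
    circ (fun x => f x - g x) t = circ f t - circ g t :=
  intervalIntegral.integral_sub (circ_integrable hf t _ _) (circ_integrable hg t _ _)

theorem circ_const_mul (c : ℝ) (f : E2 → ℝ) (t : ℝ) :
    circ (fun x => c * f x) t = c * circ f t :=
  intervalIntegral.integral_const_mul _ _

theorem integral_inv_cube {a b : ℝ} (ha : 0 < a) (hab : a ≤ b) :
    ∫ t in a..b, (t ^ 3)⁻¹ = 1 / (2 * a ^ 2) - 1 / (2 * b ^ 2) := by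
  have h : ∀ t ∈ Set.uIcc a b, HasDerivAt (fun t : ℝ => -(1 / (2 * t ^ 2))) (t ^ 3)⁻¹ t := by
    intro t ht
    rw [Set.uIcc_of_le hab] at ht
    have ht0 : t ≠ 0 := (ha.trans_le ht.1).ne'
    have := (((hasDerivAt_pow 2 t).const_mul 2).inv (by positivity)).neg
    simp only [one_div]
    refine this.congr_deriv ?_
    simp
    field_simp
  rw [intervalIntegral.integral_eq_sub_of_hasDerivAt h]
  · ring
  · refine ContinuousOn.intervalIntegrable fun t ht => ?_
    rw [Set.uIcc_of_le hab] at ht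
    have ht0 : t ≠ 0 := (ha.trans_le ht.1).ne'
    exact (ContinuousAt.inv₀ (by fun_prop) (by positivity)).continuousWithinAt

theorem abs_integral_le_of_le_div_cube {f : ℝ → ℝ} {a b C : ℝ} (ha : 0 < a) (hab : a ≤ b)
    (hC : 0 ≤ C) (h : ∀ t ∈ Set.Icc a b, |f t| ≤ C / t ^ 3) :
    |∫ t in a..b, f t| ≤ C / (2 * a ^ 2) := by
  have hi : IntervalIntegrable (fun t : ℝ => C * (t ^ 3)⁻¹) volume a b := by
    refine ContinuousOn.intervalIntegrable fun t ht => ?_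
    rw [Set.uIcc_of_le hab] at ht
    have ht0 : t ≠ 0 := (ha.trans_le ht.1).ne'
    exact (continuousAt_const.mul
      (ContinuousAt.inv₀ (by fun_prop) (by positivity))).continuousWithinAt
  have := intervalIntegral.norm_integral_le_of_norm_le (f := f) hab
    (ae_of_all _ fun t ht => h t (Set.Ioc_subset_Icc_self ht)) hi
  have e : ∫ t in a..b, C / t ^ 3 = C * ∫ t in a..b, (t ^ 3)⁻¹ := by
    rw [← intervalIntegral.integral_const_mul]
    rfl
  refine this.trans ?_
  rw [e, integral_inv_cube ha hab]
  have : 0 ≤ C * (1 / (2 * b ^ 2)) := by positivity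
  calc _ = C / (2 * a ^ 2) - C * (1 / (2 * b ^ 2)) := by ring
    _ ≤ _ := by linarith

variable {u : E2 → Eu l} (hu : ContDiff ℝ ∞ u) {ε ρ : ℝ} (h1 : ∀ x ∈ ball (0 : E2) ρ, ‖u x‖ = 1)
  (hh : IsEpsHarmonic ε (ball 0 ρ) u)

include hu in
theorem contDiff_gradSq : ContDiff ℝ ∞ (gradSq u) := by
  have e : gradSq u = fun x => ⟪pd 0 u x, pd 0 u x⟫ + ⟪pd 1 u x, pd 1 u x⟫ := by
    funext x
    rw [gradSq, real_inner_self_eq_norm_sq, real_inner_self_eq_norm_sq]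
  have := contDiff_pd hu 0
  have := contDiff_pd hu 1
  rw [e]
  fun_prop

include hu in
theorem continuous_norm_lap_sq : Continuous fun x => ‖lap u x‖ ^ 2 :=
  (contDiff_lap hu).continuous.norm.pow 2

include hu in
theorem continuous_norm_rot_sq : Continuous fun x => ‖rot u x‖ ^ 2 :=
  (contDiff_rot hu).continuous.norm.pow 2

include hu h1 hh

/-- The Pohozaev identity on the circle of radius `t`. -/
theorem pohozaev {t : ℝ} (ht : 0 < t) (htρ : t < ρ) :
    t * circ (gradSq u) t = 2 * (circ (fun x => ‖rot u x‖ ^ 2) t / t)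
      - 2 * (ε * circ (bistress u) t / t)
      + 2 * ε * ((∫ τ in (0 : ℝ)..t, τ * circ (fun x => ‖lap u x‖ ^ 2) τ) / t) := by
  have key := integral_div_annulus (contDiff_stressField hu ε 0) (contDiff_stressField hu ε 1) 0 t
  have e0 : circ (fun x => stressField ε u 0 x * x 0 + stressField ε u 1 x * x 1) 0 = 0 := by
    simp [circ]
  have e1 : circ (fun x => stressField ε u 0 x * x 0 + stressField ε u 1 x * x 1) t
      = circ (fun x => ‖rot u x‖ ^ 2) t - (1 / 2) * t ^ 2 * circ (gradSq u) t
        - ε * circ (bistress u) t := by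
    have c1 := continuous_norm_rot_sq hu
    have c2 := (contDiff_gradSq hu).continuous
    have c3 := (contDiff_bistress hu).continuous
    rw [circ_congr (g := fun x => ‖rot u x‖ ^ 2 - (1 / 2) * t ^ 2 * gradSq u x - ε * bistress u x)
      ht.le, circ_sub (by fun_prop) (by fun_prop), circ_sub (by fun_prop) (by fun_prop),
      circ_const_mul, circ_const_mul]
    intro x hx
    rw [stressField_radial, hx]
    ring
  have e2 : ∫ τ in (0 : ℝ)..t,
      τ * circ (fun x => pds 0 (stressField ε u 0) x + pds 1 (stressField ε u 1) x) τ
      = -(ε * ∫ τ in (0 : ℝ)..t, τ * circ (fun x => ‖lap u x‖ ^ 2) τ) := by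
    rw [← neg_mul, ← intervalIntegral.integral_const_mul]
    refine intervalIntegral.integral_congr fun τ hτ => ?_
    rw [Set.uIcc_of_le ht.le] at hτ
    rw [circ_congr (g := fun x => -ε * ‖lap u x‖ ^ 2) hτ.1, circ_const_mul]
    · ring
    intro x hx
    have hxU : x ∈ ball (0 : E2) ρ := by
      rw [mem_ball_zero_iff, hx]
      exact hτ.2.trans_lt htρ
    obtain ⟨c, hc⟩ := hh x hxU
    rw [div_stressField hu hc fun α => inner_pd_eq_zero hu isOpen_ball h1 hxU α]
    ring
  rw [e0, e1, e2] at key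
  field_simp
  linarith

variable {s a b : ℝ} (hε : 0 ≤ ε) (hs0 : 0 ≤ s) (hs : s ^ 2 ≤ 1 / 400) (ha : 0 < a) (hab : a ≤ b)
  (hb : b < ρ) (hεa : ε ≤ a ^ 2) (hsc : ∀ x, a ≤ ‖x‖ → ‖x‖ ≤ b → ScaledBound s u x)

include hε hs0 hs ha hab hb hεa hsc

theorem integral_circ_rot_le :
    ∫ t in a..b, circ (fun x => ‖rot u x‖ ^ 2) t / t ≤ 81000 * s ^ 2 := by
  have hπ := Real.pi_pos
  have hs1 : s ≤ 1 := by nlinarith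
  have hr := contDiff_rot hu
  have c1 := continuous_norm_rot_sq hu
  have c2 := (contDiff_gradSq hu).continuous
  have c3 := (contDiff_gradSq hr).continuous
  have hw := contDiff_lap hu
  have hT := contDiff_rotTest hu
  have w0 := contDiff_pd hw 0
  have w1 := contDiff_pd hw 1
  have t0 := contDiff_pd hT 0
  have t1 := contDiff_pd hT 1
  set Q : E2 → ℝ := fun x =>
    ⟪pd 0 (lap u) x, pd 0 (rotTest u) x⟫ + ⟪pd 1 (lap u) x, pd 1 (rotTest u) x⟫ with hQ
  have c4 : Continuous Q := (by fun_prop : ContDiff ℝ ∞ Q).continuous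
  have hxU : ∀ x : E2, ‖x‖ ≤ b → x ∈ ball (0 : E2) ρ := fun x hx => by
    rw [mem_ball_zero_iff]
    exact hx.trans_lt hb
  have key := integral_div_annulus (contDiff_rotField hu ε 0) (contDiff_rotField hu ε 1) a b
  have hbd : ∀ t ∈ Set.Icc a b,
      |circ (fun x => rotField ε u 0 x * x 0 + rotField ε u 1 x * x 1) t|
        ≤ 2 * Real.pi * (52 * s ^ 2) := by
    intro t ht
    refine abs_circ_le (ha.le.trans ht.1) fun x hx => ?_
    refine (abs_rotField_le hu (hx ▸ ha.trans_le ht.1) (hsc x (hx ▸ ht.1) (hx ▸ ht.2)) hε hs0 hs1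
      (h1 x (hxU x (hx ▸ ht.2)))).trans ?_
    have : 40 * ε * s ^ 2 / ‖x‖ ^ 2 ≤ 40 * s ^ 2 := by
      have hx0 : 0 < ‖x‖ := hx ▸ ha.trans_le ht.1
      rw [div_le_iff₀ (by positivity)]
      have : ε ≤ ‖x‖ ^ 2 := hεa.trans (by rw [hx]; exact pow_le_pow_left₀ ha.le ht.1 2)
      nlinarith [sq_nonneg s]
    linarith
  have i1 : IntervalIntegrable (fun t => circ (fun x => ‖rot u x‖ ^ 2) t / t) volume a b := by
    refine ContinuousOn.intervalIntegrable fun t ht => ?_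
    rw [Set.uIcc_of_le hab] at ht
    have ht0 : t ≠ 0 := (ha.trans_le ht.1).ne'
    exact ((continuous_circ c1).continuousAt.div continuousAt_id ht0).continuousWithinAt
  have ci : ∀ {g : E2 → ℝ}, Continuous g →
      IntervalIntegrable (fun t => t * circ g t) volume a b := fun hg =>
    (continuous_id.mul (continuous_circ hg)).intervalIntegrable _ _
  have e1 : ∫ t in a..b, t * circ (fun x => pds 0 (rotField ε u 0) x + pds 1 (rotField ε u 1) x) t
      = (∫ t in a..b, t * circ (gradSq (rot u)) t)
        - (∫ t in a..b, t * circ (fun x => ‖rot u x‖ ^ 2 * gradSq u x) t)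
        + ∫ t in a..b, ε * (t * circ Q t) := by
    rw [← intervalIntegral.integral_sub (ci c3) (ci (by fun_prop)),
      ← intervalIntegral.integral_add ((ci c3).sub (ci (by fun_prop))) ((ci c4).const_mul ε)]
    refine intervalIntegral.integral_congr fun t ht => ?_
    rw [Set.uIcc_of_le hab] at ht
    rw [circ_congr (g := fun x => gradSq (rot u) x - ‖rot u x‖ ^ 2 * gradSq u x + ε * Q x)
      (ha.le.trans ht.1), circ_add (by fun_prop) (by fun_prop), circ_sub c3 (by fun_prop),
      circ_const_mul]
    · ring
    intro x hx
    have hx' := hxU x (hx ▸ ht.2)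
    obtain ⟨c, hc⟩ := hh x hx'
    exact div_rotField hu isOpen_ball h1 hx' hc
  have e2 : ∫ t in a..b, t * circ (fun x => ‖rot u x‖ ^ 2 * gradSq u x) t
      ≤ 2 * s ^ 2 * ∫ t in a..b, circ (fun x => ‖rot u x‖ ^ 2) t / t := by
    rw [← intervalIntegral.integral_const_mul]
    refine intervalIntegral.integral_mono_on hab (ci (by fun_prop)) (i1.const_mul _) fun t ht => ?_
    have ht0 : 0 < t := ha.trans_le ht.1
    have : circ (fun x => ‖rot u x‖ ^ 2 * gradSq u x) t
        ≤ 2 * s ^ 2 / t ^ 2 * circ (fun x => ‖rot u x‖ ^ 2) t := by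
      rw [← circ_const_mul]
      refine circ_mono (by fun_prop) (by fun_prop) ht0.le fun x hx => ?_
      rw [mul_comm]
      have := gradSq_le_of_scaledBound (hsc x (hx ▸ ht.1) (hx ▸ ht.2))
      rw [hx] at this
      gcongr
    refine (mul_le_mul_of_nonneg_left this ht0.le).trans_eq ?_
    field_simp
  have e3 : |∫ t in a..b, ε * (t * circ Q t)| ≤ 216 * Real.pi * (ε * s ^ 2) / (2 * a ^ 2) := by
    refine abs_integral_le_of_le_div_cube ha hab (by positivity) fun t ht => ?_
    have ht0 : 0 < t := ha.trans_le ht.1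
    have : |circ Q t| ≤ 2 * Real.pi * (108 * s ^ 2 / t ^ 4) := by
      refine abs_circ_le ht0.le fun x hx => ?_
      have := abs_inner_pd_lap_pd_rotTest_le hu (hx ▸ ht0) (hsc x (hx ▸ ht.1) (hx ▸ ht.2)) hs0 hs1
        (h1 x (hxU x (hx ▸ ht.2)))
      rwa [hx] at this
    rw [abs_mul, abs_mul, abs_of_nonneg hε, abs_of_pos ht0]
    calc _ ≤ ε * (t * (2 * Real.pi * (108 * s ^ 2 / t ^ 4))) := by gcongr
      _ = _ := by field_simp; ring
  have e3' : 216 * Real.pi * (ε * s ^ 2) / (2 * a ^ 2) ≤ 108 * Real.pi * s ^ 2 := by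
    rw [div_le_iff₀ (by positivity)]
    have := mul_le_mul_of_nonneg_left hεa (by positivity : 0 ≤ 216 * Real.pi * s ^ 2)
    linarith
  have e4 : ∫ t in a..b, circ (fun x => ‖rot u x‖ ^ 2) t / t
      ≤ 4 * Real.pi ^ 2 * ∫ t in a..b, t * circ (gradSq (rot u)) t := by
    rw [← intervalIntegral.integral_const_mul]
    refine intervalIntegral.integral_mono_on hab i1 ((ci c3).const_mul _) fun t ht => ?_
    have ht0 : 0 < t := ha.trans_le ht.1
    rw [div_le_iff₀ ht0]
    refine (circ_rot_le hu t).trans ?_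
    have : circ (fun x => ‖rot (rot u) x‖ ^ 2) t ≤ t ^ 2 * circ (gradSq (rot u)) t := by
      rw [← circ_const_mul]
      refine circ_mono (continuous_norm_rot_sq hr) (by fun_prop) ht0.le fun x hx => ?_
      rw [← hx]
      exact norm_rot_sq_le _ _
    refine (mul_le_mul_of_nonneg_left this (by positivity)).trans_eq (by ring)
  have i0 : 0 ≤ ∫ t in a..b, circ (fun x => ‖rot u x‖ ^ 2) t / t :=
    intervalIntegral.integral_nonneg hab fun t ht =>
      div_nonneg (circ_nonneg fun x => sq_nonneg _) (ha.le.trans ht.1)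
  set I := ∫ t in a..b, circ (fun x => ‖rot u x‖ ^ 2) t / t
  have fa := abs_le.1 (hbd a ⟨le_rfl, hab⟩)
  have fb := abs_le.1 (hbd b ⟨hab, le_rfl⟩)
  have f3 := abs_le.1 e3
  rw [e1] at key
  have g : ∫ t in a..b, t * circ (gradSq (rot u)) t ≤ 316 * Real.pi * s ^ 2 + 2 * s ^ 2 * I := by
    linarith
  have p2 : Real.pi ^ 2 ≤ 9.93 := by nlinarith [Real.pi_lt_d2]
  have p3 : Real.pi ^ 3 ≤ 31.3 := by
    have := mul_le_mul p2 Real.pi_lt_d2.le hπ.le (by norm_num)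
    nlinarith
  have h4 := mul_le_mul_of_nonneg_left g (by positivity : 0 ≤ 4 * Real.pi ^ 2)
  have q1 : Real.pi ^ 2 * (s ^ 2 * I) ≤ 9.93 * (1 / 400 * I) := by gcongr
  have q2 := mul_le_mul_of_nonneg_right p3 (sq_nonneg s)
  nlinarith

/-- In a neck the `ε`-energy is, up to a small error, `2 ε log (b / a)` times the energy of the
Laplacian inside the neck. -/
theorem neck_estimate :
    |(∫ t in a..b, t * circ (eDen ε u) t)
      - 2 * (ε * Real.log (b / a)) * ∫ t in (0 : ℝ)..a, t * circ (fun x => ‖lap u x‖ ^ 2) t|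
      ≤ 200000 * s ^ 2 * (1 + ε * Real.log (b / a) / a ^ 2) := by
  have hπ := Real.pi_pos
  have hb0 : 0 < b := ha.trans_le hab
  have c1 := continuous_norm_rot_sq hu
  have c2 := (contDiff_gradSq hu).continuous
  have c3 := continuous_norm_lap_sq hu
  have c4 := (contDiff_bistress hu).continuous
  set L : ℝ → ℝ := fun t => t * circ (fun x => ‖lap u x‖ ^ 2) t with hL
  have cL : Continuous L := continuous_id.mul (continuous_circ c3)
  set N : ℝ → ℝ := fun t => ∫ τ in (0 : ℝ)..t, L τ with hN
  have cN : Continuous N := intervalIntegral.continuous_primitive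
    (fun _ _ => cL.intervalIntegrable _ _) 0
  have cdiv : ∀ {g : ℝ → ℝ}, Continuous g →
      IntervalIntegrable (fun t => g t / t) volume a b := fun hg => by
    refine ContinuousOn.intervalIntegrable fun t ht => ?_
    rw [Set.uIcc_of_le hab] at ht
    have ht0 : t ≠ 0 := (ha.trans_le ht.1).ne'
    exact (hg.continuousAt.div continuousAt_id ht0).continuousWithinAt
  have iA := cdiv (continuous_circ c1)
  have iB := cdiv ((continuous_circ c4).const_mul ε)
  have iN : IntervalIntegrable (fun t => (N t - N a) / t) volume a b :=
    cdiv (cN.sub continuous_const)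
  have iL : IntervalIntegrable L volume a b := cL.intervalIntegrable _ _
  have i1 : IntervalIntegrable (fun t : ℝ => 1 / t) volume a b := cdiv continuous_const
  have split : ∫ t in a..b, t * circ (eDen ε u) t
      = 2 * (∫ t in a..b, circ (fun x => ‖rot u x‖ ^ 2) t / t)
        - 2 * (∫ t in a..b, ε * circ (bistress u) t / t)
        + 2 * ε * (∫ t in a..b, (N t - N a) / t)
        + 2 * ε * N a * (∫ t in a..b, 1 / t)
        + ε * ∫ t in a..b, L t := by
    simp only [← intervalIntegral.integral_const_mul]
    rw [← intervalIntegral.integral_sub (iA.const_mul _) (iB.const_mul _),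
      ← intervalIntegral.integral_add ((iA.const_mul _).sub (iB.const_mul _)) (iN.const_mul _),
      ← intervalIntegral.integral_add (((iA.const_mul _).sub (iB.const_mul _)).add
        (iN.const_mul _)) (i1.const_mul _),
      ← intervalIntegral.integral_add ((((iA.const_mul _).sub (iB.const_mul _)).add
        (iN.const_mul _)).add (i1.const_mul _)) (iL.const_mul _)]
    refine intervalIntegral.integral_congr fun t ht => ?_
    rw [Set.uIcc_of_le hab] at ht
    have ht0 : 0 < t := ha.trans_le ht.1
    have e : circ (eDen ε u) t = circ (gradSq u) t + ε * circ (fun x => ‖lap u x‖ ^ 2) t := by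
      rw [← circ_const_mul, ← circ_add c2 (by fun_prop)]
      rfl
    rw [e, mul_add, pohozaev hu h1 hh ht0 (ht.2.trans_lt hb)]
    simp only [hL, hN]
    ring
  have log_eq : ∫ t in a..b, 1 / t = Real.log (b / a) := integral_one_div_of_pos ha hb0
  have log_nonneg : 0 ≤ Real.log (b / a) := Real.log_nonneg ((one_le_div ha).2 hab)
  have bL : ∀ t ∈ Set.Icc a b, |L t| ≤ 8 * Real.pi * s ^ 2 / t ^ 3 := by
    intro t ht
    have ht0 : 0 < t := ha.trans_le ht.1
    have : |circ (fun x => ‖lap u x‖ ^ 2) t| ≤ 2 * Real.pi * (4 * s ^ 2 / t ^ 4) := by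
      refine abs_circ_le ht0.le fun x hx => ?_
      rw [abs_of_nonneg (sq_nonneg _), ← hx]
      exact norm_lap_sq_le_of_scaledBound (hsc x (hx ▸ ht.1) (hx ▸ ht.2))
    simp only [hL]
    rw [abs_mul, abs_of_pos ht0]
    refine (mul_le_mul_of_nonneg_left this ht0.le).trans_eq ?_
    field_simp
    ring
  have bN : ∀ t ∈ Set.Icc a b, |N t - N a| ≤ 8 * Real.pi * s ^ 2 / (2 * a ^ 2) := by
    intro t ht
    have : N t - N a = ∫ τ in a..t, L τ := intervalIntegral.integral_interval_sub_left
      (cL.intervalIntegrable _ _) (cL.intervalIntegrable _ _)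
    rw [this]
    exact abs_integral_le_of_le_div_cube ha ht.1 (by positivity)
      fun τ hτ => bL τ ⟨hτ.1, hτ.2.trans ht.2⟩
  have b1 := integral_circ_rot_le hu h1 hh hε hs0 hs ha hab hb hεa hsc
  have b1' : 0 ≤ ∫ t in a..b, circ (fun x => ‖rot u x‖ ^ 2) t / t :=
    intervalIntegral.integral_nonneg hab fun t ht =>
      div_nonneg (circ_nonneg fun x => sq_nonneg _) (ha.le.trans ht.1)
  have εa : ε / a ^ 2 ≤ 1 := (div_le_one (by positivity)).2 hεa
  have b2 : |∫ t in a..b, ε * circ (bistress u) t / t| ≤ 22 * Real.pi * s ^ 2 := by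
    have : |∫ t in a..b, ε * circ (bistress u) t / t|
        ≤ 44 * Real.pi * (ε * s ^ 2) / (2 * a ^ 2) := by
      refine abs_integral_le_of_le_div_cube ha hab (by positivity) fun t ht => ?_
      have ht0 : 0 < t := ha.trans_le ht.1
      have : |circ (bistress u) t| ≤ 2 * Real.pi * (22 * s ^ 2 / t ^ 2) := by
        refine abs_circ_le ht0.le fun x hx => ?_
        rw [← hx]
        exact abs_bistress_le hu (hx ▸ ht0) (hsc x (hx ▸ ht.1) (hx ▸ ht.2))
      rw [abs_div, abs_mul, abs_of_nonneg hε, abs_of_pos ht0]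
      calc _ ≤ ε * (2 * Real.pi * (22 * s ^ 2 / t ^ 2)) / t := by gcongr
        _ = _ := by field_simp; ring
    refine this.trans ?_
    calc _ = 22 * Real.pi * s ^ 2 * (ε / a ^ 2) := by field_simp; ring
      _ ≤ 22 * Real.pi * s ^ 2 * 1 := by gcongr
      _ = _ := mul_one _
  have b3 : |∫ t in a..b, (N t - N a) / t|
      ≤ 8 * Real.pi * s ^ 2 / (2 * a ^ 2) * Real.log (b / a) := by
    rw [← log_eq, ← intervalIntegral.integral_const_mul]
    refine intervalIntegral.norm_integral_le_of_norm_le (f := fun t => (N t - N a) / t) hab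
      (ae_of_all _ fun t ht => ?_) (i1.const_mul _)
    have ht0 : 0 < t := ha.trans ht.1
    rw [norm_div, Real.norm_eq_abs, Real.norm_of_nonneg ht0.le, mul_one_div]
    have := bN t (Set.Ioc_subset_Icc_self ht)
    gcongr
  have b3' : |2 * ε * ∫ t in a..b, (N t - N a) / t|
      ≤ 8 * Real.pi * s ^ 2 * (ε * Real.log (b / a) / a ^ 2) := by
    rw [abs_mul, abs_of_nonneg (by positivity)]
    refine (mul_le_mul_of_nonneg_left b3 (by positivity)).trans_eq ?_
    field_simp
  have b4 : |ε * ∫ t in a..b, L t| ≤ 4 * Real.pi * s ^ 2 := by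
    rw [abs_mul, abs_of_nonneg hε]
    refine (mul_le_mul_of_nonneg_left (abs_integral_le_of_le_div_cube ha hab (by positivity) bL)
      hε).trans ?_
    calc _ = 4 * Real.pi * s ^ 2 * (ε / a ^ 2) := by field_simp; ring
      _ ≤ 4 * Real.pi * s ^ 2 * 1 := by gcongr
      _ = _ := mul_one _
  rw [split, log_eq]
  have X0 : 0 ≤ ε * Real.log (b / a) / a ^ 2 := by positivity
  set X := ε * Real.log (b / a) / a ^ 2
  have NA : (∫ t in (0 : ℝ)..a, L t) = N a := rfl
  rw [NA]
  have πs : Real.pi * s ^ 2 ≤ 4 * s ^ 2 := by gcongr; exact Real.pi_le_four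
  have πsX : Real.pi * s ^ 2 * X ≤ 4 * s ^ 2 * X := by gcongr
  have s0 := sq_nonneg s
  have sX : 0 ≤ s ^ 2 * X := by positivity
  rw [abs_le] at b2 b3' b4 ⊢
  constructor <;> nlinarith
end Neck

section Reduction

variable {l : ℕ}

theorem _root_.Filter.EventuallyEq.pd {u v : E2 → Eu l} {x : E2} (h : u =ᶠ[nhds x] v)
    (α : Fin 2) : pd α u =ᶠ[nhds x] pd α v := by
  filter_upwards [h.fderiv (𝕜 := ℝ)] with y hy
  rw [_root_.pd, _root_.pd, hy]

theorem _root_.Filter.EventuallyEq.lap {u v : E2 → Eu l} {x : E2} (h : u =ᶠ[nhds x] v) :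
    lap u =ᶠ[nhds x] lap v :=
  ((h.pd 0).pd 0).add ((h.pd 1).pd 1)

theorem _root_.Filter.EventuallyEq.eDen_eq {u v : E2 → Eu l} {x : E2} (h : u =ᶠ[nhds x] v)
    (ε : ℝ) : eDen ε u x = eDen ε v x := by
  rw [eDen, eDen, gradSq, gradSq, (h.pd 0).eq_of_nhds, (h.pd 1).eq_of_nhds, h.lap.eq_of_nhds]

theorem exists_contDiff_eqOn_ball {u : E2 → Eu l} (hu : ContDiffOn ℝ ∞ u (ball 0 1)) :
    ∃ v : E2 → Eu l, ContDiff ℝ ∞ v ∧ Set.EqOn v u (ball 0 (1 / 2)) := by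
  let f : ContDiffBump (0 : E2) := ⟨1 / 2, 3 / 4, by norm_num, by norm_num⟩
  refine ⟨fun x => f x • u x, contDiff_iff_contDiffAt.2 fun x => ?_, fun x hx => ?_⟩
  · by_cases hx : x ∈ ball (0 : E2) 1
    · exact f.contDiffAt.smul (hu.contDiffAt (isOpen_ball.mem_nhds hx))
    · have h : x ∉ tsupport f := by
        rw [f.tsupport_eq]
        intro h
        exact hx (closedBall_subset_ball (by norm_num : (3 / 4 : ℝ) < 1) h)
      refine (contDiffAt_const (c := (0 : Eu l))).congr_of_eventuallyEq ?_
      filter_upwards [notMem_tsupport_iff_eventuallyEq.1 h] with y hy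
      simp [hy]
  · have : f x = 1 := f.one_of_mem_closedBall (ball_subset_closedBall hx)
    simp [this]

theorem norm_iteratedFDeriv_pd_le {v : E2 → Eu l} (hv : ContDiff ℝ ∞ v) (α : Fin 2) (n : ℕ)
    (x : E2) : ‖iteratedFDeriv ℝ n (pd α v) x‖ ≤ ‖iteratedFDeriv ℝ (n + 1) v x‖ := by
  have h := norm_iteratedFDeriv_clm_apply_const (c := EuclideanSpace.single α (1 : ℝ)) (x := x)
    (hv.fderiv_right (m := ∞) (by simp)).contDiffAt (n := n) (by exact_mod_cast le_top)
  rw [norm_iteratedFDeriv_fderiv] at h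
  rwa [PiLp.norm_single, norm_one, one_mul] at h

theorem norm_pd_le {v : E2 → Eu l} (hv : ContDiff ℝ ∞ v) (α : Fin 2) (x : E2) :
    ‖pd α v x‖ ≤ ‖iteratedFDeriv ℝ 1 v x‖ := by
  simpa using norm_iteratedFDeriv_pd_le hv α 0 x

theorem norm_pd_pd_le {v : E2 → Eu l} (hv : ContDiff ℝ ∞ v) (α β : Fin 2) (x : E2) :
    ‖pd α (pd β v) x‖ ≤ ‖iteratedFDeriv ℝ 2 v x‖ :=
  (norm_pd_le (contDiff_pd hv β) α x).trans (norm_iteratedFDeriv_pd_le hv β 1 x)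

theorem norm_pd_pd_pd_le {v : E2 → Eu l} (hv : ContDiff ℝ ∞ v) (α β γ : Fin 2) (x : E2) :
    ‖pd α (pd β (pd γ v)) x‖ ≤ ‖iteratedFDeriv ℝ 3 v x‖ :=
  (norm_pd_pd_le (contDiff_pd hv γ) α β x).trans (norm_iteratedFDeriv_pd_le hv γ 2 x)

theorem norm_lap_sub_le {v w : E2 → Eu l} (hv : ContDiff ℝ ∞ v) (hw : ContDiff ℝ ∞ w) (x : E2) :
    ‖lap v x - lap w x‖ ≤ 2 * ‖iteratedFDeriv ℝ 2 v x - iteratedFDeriv ℝ 2 w x‖ := by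
  have hs : ContDiff ℝ ∞ (fun y => v y - w y) := hv.sub hw
  have e1 : ∀ α, pd α (fun y => v y - w y) = fun y => pd α v y - pd α w y :=
    fun α => funext fun y => pd_sub hv hw α y
  have e : lap v x - lap w x = lap (fun y => v y - w y) x := by
    rw [lap, lap, lap, e1, e1, pd_sub (contDiff_pd hv 0) (contDiff_pd hw 0),
      pd_sub (contDiff_pd hv 1) (contDiff_pd hw 1)]
    abel
  have e2 : iteratedFDeriv ℝ 2 v x - iteratedFDeriv ℝ 2 w x
      = iteratedFDeriv ℝ 2 (fun y => v y - w y) x :=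
    (iteratedFDeriv_sub_apply (contDiff_infty.1 hv 2).contDiffAt
      (contDiff_infty.1 hw 2).contDiffAt).symm
  rw [e, e2, two_mul]
  exact (norm_add_le _ _).trans (add_le_add (norm_pd_pd_le hs 0 0 x) (norm_pd_pd_le hs 1 1 x))

theorem pd_comp_smul (v : E2 → Eu l) (r : ℝ) (α : Fin 2) (y : E2) :
    pd α (fun z => v (r • z)) y = r • pd α v (r • y) := by
  rw [pd, pd, fderiv_comp_smul]
  rfl

theorem lap_comp_smul {v : E2 → Eu l} (hv : ContDiff ℝ ∞ v) (r : ℝ) (y : E2) :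
    lap (fun z => v (r • z)) y = r ^ 2 • lap v (r • y) := by
  have h : ∀ α, pd α (pd α fun z => v (r • z)) y = r ^ 2 • pd α (pd α v) (r • y) := by
    intro α
    have e : pd α (fun z => v (r • z)) = fun y => r • pd α v (r • y) :=
      funext fun y => pd_comp_smul v r α y
    have hα := contDiff_pd hv α
    have h := pd_smul contDiff_const (hα.comp (contDiff_const_smul r)) α y (c := fun _ => r)
    simp only [Function.comp_def, pds_const, zero_smul, zero_add] at h
    rw [e, h, pd_comp_smul, smul_smul, sq]
  rw [lap, lap, h, h, smul_add]

theorem integral_circ_lap_comp_smul {v : E2 → Eu l} (hv : ContDiff ℝ ∞ v) (r R : ℝ) :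
    ∫ t in (0 : ℝ)..R, t * circ (fun x => ‖lap (fun z => v (r • z)) x‖ ^ 2) t
      = r ^ 2 * ∫ t in (0 : ℝ)..R * r, t * circ (fun x => ‖lap v x‖ ^ 2) t := by
  have h := intervalIntegral.mul_integral_comp_mul_left (a := 0) (b := R)
    (f := fun t => t * circ (fun x => ‖lap v x‖ ^ 2) t) (c := r)
  rw [mul_zero, mul_comm r R] at h
  rw [← h, ← intervalIntegral.integral_const_mul, ← intervalIntegral.integral_const_mul]
  refine intervalIntegral.integral_congr fun t _ => ?_
  have e : circ (fun x => ‖lap (fun z => v (r • z)) x‖ ^ 2) t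
      = r ^ 4 * circ (fun x => ‖lap v x‖ ^ 2) (r * t) := by
    rw [← circ_const_mul]
    refine intervalIntegral.integral_congr fun θ _ => ?_
    have : r • pt (t * Real.cos θ) (t * Real.sin θ)
        = pt (r * t * Real.cos θ) (r * t * Real.sin θ) := by
      simp only [pt_eq, smul_add, smul_smul, mul_assoc]
    simp only
    rw [lap_comp_smul hv, this, norm_smul, mul_pow, Real.norm_eq_abs, sq_abs]
    ring
  rw [e]
  ring

theorem abs_integral_circ_sub_le {f g : E2 → ℝ} (hf : Continuous f) (hg : Continuous g) {R B : ℝ}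
    (hR : 0 ≤ R) (h : ∀ x, ‖x‖ ≤ R → |f x - g x| ≤ B) :
    |(∫ t in (0 : ℝ)..R, t * circ f t) - ∫ t in (0 : ℝ)..R, t * circ g t|
      ≤ 2 * Real.pi * R ^ 2 * B := by
  have ci : ∀ {g : E2 → ℝ}, Continuous g →
      IntervalIntegrable (fun t => t * circ g t) volume 0 R := fun hg =>
    (continuous_id.mul (continuous_circ hg)).intervalIntegrable _ _
  rw [← intervalIntegral.integral_sub (ci hf) (ci hg)]
  have := intervalIntegral.norm_integral_le_of_norm_le_const (a := 0) (b := R)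
    (f := fun t => t * circ f t - t * circ g t) (C := R * (2 * Real.pi * B)) fun t ht => by
      rw [Set.uIoc_of_le hR] at ht
      rw [← mul_sub, ← circ_sub hf hg, norm_mul, Real.norm_of_nonneg ht.1.le]
      exact mul_le_mul ht.2 (abs_circ_le ht.1.le fun x hx => h x (hx ▸ ht.2)) (norm_nonneg _) hR
  rw [sub_zero, abs_of_nonneg hR] at this
  exact this.trans_eq (by ring)

theorem abs_norm_sq_sub_norm_sq_le {F : Type*} [SeminormedAddCommGroup F] {a b : F} {τ M : ℝ}
    (h : ‖a - b‖ ≤ τ) (hb : ‖b‖ ≤ M) : |‖a‖ ^ 2 - ‖b‖ ^ 2| ≤ τ * (τ + 2 * M) := by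
  have h1 : |‖a‖ - ‖b‖| ≤ τ := (abs_norm_sub_norm_le a b).trans h
  have h2 : ‖a‖ + ‖b‖ ≤ τ + 2 * M := by linarith [(abs_le.1 h1).2]
  rw [sq_sub_sq, abs_mul, abs_of_nonneg (by positivity : 0 ≤ ‖a‖ + ‖b‖), mul_comm]
  exact mul_le_mul h1 h2 (by positivity) ((abs_nonneg _).trans h1)

theorem tendsto_integral_circ_lap {w : ℕ → E2 → Eu l} {v : E2 → Eu l}
    (hw : ∀ k, ContDiff ℝ ∞ (w k)) (hv : ContDiff ℝ ∞ v) {R : ℝ} (hR : 0 ≤ R)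
    (h : TendstoUniformlyOn (fun k => iteratedFDeriv ℝ 2 (w k)) (iteratedFDeriv ℝ 2 v) atTop
      (closedBall 0 R)) :
    Tendsto (fun k => ∫ t in (0 : ℝ)..R, t * circ (fun x => ‖lap (w k) x‖ ^ 2) t) atTop
      (nhds (∫ x in ball (0 : E2) R, ‖lap v x‖ ^ 2)) := by
  rw [setIntegral_ball (continuous_norm_lap_sq hv) hR]
  obtain ⟨M, hM⟩ := (isCompact_closedBall (0 : E2) R).exists_bound_of_continuousOn
    (contDiff_lap hv).continuous.continuousOn
  have hlim : Tendsto (fun τ : ℝ => 2 * Real.pi * R ^ 2 * (2 * τ * (2 * τ + 2 * M)))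
      (nhds 0) (nhds 0) := by
    have : Continuous fun τ : ℝ => 2 * Real.pi * R ^ 2 * (2 * τ * (2 * τ + 2 * M)) := by fun_prop
    simpa using this.tendsto 0
  rw [Metric.tendsto_atTop]
  intro η hη
  have hev := (hlim.mono_left (nhdsWithin_le_nhds (s := Set.Ioi 0))).eventually (gt_mem_nhds hη)
  obtain ⟨τ, hτη, hτ⟩ := (hev.and (self_mem_nhdsWithin (s := Set.Ioi (0 : ℝ)))).exists
  obtain ⟨K, hK⟩ := eventually_atTop.1 (Metric.tendstoUniformlyOn_iff.1 h τ hτ)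
  refine ⟨K, fun k hk => (abs_integral_circ_sub_le (continuous_norm_lap_sq (hw k))
    (continuous_norm_lap_sq hv) hR fun x hx => ?_).trans_lt hτη⟩
  have hx' : x ∈ closedBall (0 : E2) R := mem_closedBall_zero_iff.2 hx
  have d := hK k hk x hx'
  rw [dist_comm, dist_eq_norm] at d
  refine abs_norm_sq_sub_norm_sq_le ((norm_lap_sub_le (hw k) hv x).trans ?_) (hM x hx')
  linarith

theorem measurableSet_ann (a b : ℝ) : MeasurableSet (ann a b) :=
  continuous_norm.measurable measurableSet_Ioo

/-- The neck estimate for a map defined on the unit disk, written in terms of its rescaling. -/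
theorem neck_estimate_comp_smul {u v : E2 → Eu l} {ε r R R₀ s : ℝ}
    (hv : ContDiff ℝ ∞ v) (hvu : Set.EqOn v u (ball 0 (1 / 2))) (h1 : ∀ x ∈ ball (0 : E2) 1, ‖u x‖ = 1)
    (hh : IsEpsHarmonic ε (ball 0 1) u) (hε : 0 ≤ ε) (hr : 0 < r) (hR : 1 ≤ R)
    (hRr : R * r ≤ R₀) (hR₀ : R₀ < 1 / 2) (hεr : ε ≤ r ^ 2) (hs0 : 0 ≤ s) (hs : s ^ 2 ≤ 1 / 400)
    (hsc : ∀ t ∈ ({1, 2, 3} : Set ℕ), ∀ x : E2, R * r ≤ ‖x‖ → ‖x‖ ≤ R₀ →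
      ‖iteratedFDeriv ℝ t u x‖ ≤ s / ‖x‖ ^ t) :
    |(∫ x in ann (R * r) R₀, eDen ε u x) - 2 * (ε / r ^ 2 * Real.log (R₀ / (R * r))) *
          ∫ t in (0 : ℝ)..R, t * circ (fun x => ‖lap (fun z => v (r • z)) x‖ ^ 2) t|
      ≤ 200000 * s ^ 2 * (1 + ε / r ^ 2 * Real.log (R₀ / (R * r))) := by
  have ev : ∀ x ∈ ball (0 : E2) (1 / 2), v =ᶠ[nhds x] u := fun x hx =>
    hvu.eventuallyEq_of_mem (isOpen_ball.mem_nhds hx)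
  have hsub : ball (0 : E2) (1 / 2) ⊆ ball 0 1 := ball_subset_ball (by norm_num)
  have ha : 0 < R * r := by positivity
  have mem : ∀ x : E2, ‖x‖ ≤ R₀ → x ∈ ball (0 : E2) (1 / 2) := fun x hx =>
    mem_ball_zero_iff.2 (hx.trans_lt hR₀)
  have hharm : IsEpsHarmonic ε (ball 0 (1 / 2)) v := by
    intro x hx
    have e := ev x hx
    rw [e.lap.eq_of_nhds, e.lap.lap.eq_of_nhds, e.eq_of_nhds]
    exact hh x (hsub hx)
  have hr2 : r ^ 2 ≤ (R * r) ^ 2 := pow_le_pow_left₀ hr.le (le_mul_of_one_le_left hr.le hR) 2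
  have hbound : ∀ x, R * r ≤ ‖x‖ → ‖x‖ ≤ R₀ → ScaledBound s v x := by
    intro x hx hx'
    have hb : ∀ t ∈ ({1, 2, 3} : Set ℕ), ‖iteratedFDeriv ℝ t v x‖ ≤ s / ‖x‖ ^ t := by
      intro t ht
      rw [((ev x (mem x hx')).iteratedFDeriv ℝ t).eq_of_nhds]
      exact hsc t ht x hx hx'
    have b1 := hb 1 (by simp)
    rw [pow_one] at b1
    exact ⟨fun α => (norm_pd_le hv α x).trans b1,
      fun α β => (norm_pd_pd_le hv α β x).trans (hb 2 (by simp)),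
      fun α β γ => (norm_pd_pd_pd_le hv α β γ x).trans (hb 3 (by simp))⟩
  have key := neck_estimate hv (fun x hx => by rw [hvu hx]; exact h1 x (hsub hx)) hharm hε hs0 hs
    ha hRr hR₀ (hεr.trans hr2) hbound
  have c2 : Continuous (eDen ε v) :=
    (contDiff_gradSq hv).continuous.add (continuous_const.mul (continuous_norm_lap_sq hv))
  have e1 : ∫ x in ann (R * r) R₀, eDen ε u x = ∫ t in (R * r)..R₀, t * circ (eDen ε v) t := by
    rw [← setIntegral_ann c2 ha.le hRr]
    refine setIntegral_congr_fun (measurableSet_ann _ _) fun x hx => ?_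
    exact ((ev x (mem x hx.2.le)).eDen_eq ε).symm
  have log0 : 0 ≤ Real.log (R₀ / (R * r)) := Real.log_nonneg ((one_le_div ha).2 hRr)
  rw [e1, integral_circ_lap_comp_smul hv]
  have e2 : 2 * (ε / r ^ 2 * Real.log (R₀ / (R * r))) *
      (r ^ 2 * ∫ t in (0 : ℝ)..R * r, t * circ (fun x => ‖lap v x‖ ^ 2) t)
      = 2 * (ε * Real.log (R₀ / (R * r))) *
        ∫ t in (0 : ℝ)..R * r, t * circ (fun x => ‖lap v x‖ ^ 2) t := by
    field_simp
  rw [e2]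
  refine key.trans ?_
  have : ε * Real.log (R₀ / (R * r)) / (R * r) ^ 2 ≤ ε / r ^ 2 * Real.log (R₀ / (R * r)) := by
    rw [div_mul_eq_mul_div]
    gcongr
  gcongr

theorem tendsto_setIntegral_ball_atTop {f : E2 → ℝ} (hf : Integrable f) :
    Tendsto (fun R : ℝ => ∫ x in ball (0 : E2) R, f x) atTop (nhds (∫ x, f x)) := by
  have h := tendsto_setIntegral_of_monotone (μ := volume) (f := f)
    (s := fun R : ℝ => ball (0 : E2) R) (fun R => measurableSet_ball)
    (fun _ _ h => ball_subset_ball h) hf.integrableOn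
  have e : ⋃ R : ℝ, ball (0 : E2) R = Set.univ :=
    Set.eq_univ_of_forall fun x => Set.mem_iUnion.2 ⟨‖x‖ + 1, by simp⟩
  rwa [e, setIntegral_univ] at h

end Reduction

end

/-- generalised energy identity for the neck energy. Under the single-bubble
hypotheses, if `μ = lim (ε_k/r_k²) log(1/r_k)` exists, then the iterated limit
`lim_{R₀→0} lim_{R→∞} lim_k ∫_{A(Rr_k, R₀)} (|∇u_k|² + ε_k|Δu_k|²) = 2μ ∫_{ℝ²} |Δω|²`,
stated in ε–δ form (which encodes that the iterated limits of both the `limsup` and the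
`liminf` in `k` exist and take this common value). -/
theorem generalised_neck_energy_identity {l : ℕ} (hl : 2 ≤ l)
    (ε : ℕ → ℝ) (hεpos : ∀ k, 0 < ε k) (hε0 : Filter.Tendsto ε Filter.atTop (nhds 0))
    (u : ℕ → E2 → Eu l)
    (hsm : ∀ k, ContDiffOn ℝ (⊤ : ℕ∞) (u k) (Metric.ball 0 1))
    (hsph : ∀ k, ∀ x ∈ Metric.ball (0 : E2) 1, ‖u k x‖ = 1)
    (hharm : ∀ k, IsEpsHarmonic (ε k) (Metric.ball 0 1) (u k))
    (hbd : ∃ Λ : ℝ, ∀ k, (∫ x in Metric.ball (0 : E2) 1, eDen (ε k) (u k) x) ≤ Λ)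
    (r : ℕ → ℝ) (hrpos : ∀ k, 0 < r k) (hr0 : Filter.Tendsto r Filter.atTop (nhds 0))
    (ω : E2 → Eu l) (hω : ContDiff ℝ (⊤ : ℕ∞) ω) (hωnc : ∃ x y : E2, ω x ≠ ω y)
    (hωE : 0 < ∫ x : E2, ‖lap ω x‖ ^ 2)
    (hωI : MeasureTheory.Integrable (fun x : E2 => ‖lap ω x‖ ^ 2))
    (hconv : ∀ K : Set E2, IsCompact K → ∀ t : ℕ, t ≤ 3 →
      TendstoUniformlyOn (fun k y => iteratedFDeriv ℝ t (fun z => u k ((r k) • z)) y)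
        (iteratedFDeriv ℝ t ω) Filter.atTop K)
    (hneck : ∀ δ : ℝ, 0 < δ → ∃ R : ℝ, 1 ≤ R ∧ ∃ R₀ : ℝ, R₀ ∈ Set.Ioo (0 : ℝ) 1 ∧
      ∃ K : ℕ, ∀ k ≥ K,
        (∀ t ∈ ({1, 2, 3} : Set ℕ), ∀ x : E2, 2 * R * r k ≤ ‖x‖ → ‖x‖ ≤ R₀ / 4 →
          ‖iteratedFDeriv ℝ t (u k) x‖ ≤ Real.sqrt δ / ‖x‖ ^ t) ∧
        (∀ a : ℝ, R * r k < a → a < R₀ / 2 →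
          (∫ x in ann a (2 * a), eDen (ε k) (u k) x) ≤ δ))
    (μ : ℝ)
    (hμ : Filter.Tendsto (fun k => (ε k / (r k) ^ 2) * Real.log (1 / r k))
      Filter.atTop (nhds μ)) :
    ∀ η : ℝ, 0 < η → ∃ R₀' : ℝ, 0 < R₀' ∧ ∀ R₀ : ℝ, 0 < R₀ → R₀ < R₀' →
      ∃ R' : ℝ, 1 ≤ R' ∧ ∀ R : ℝ, R' ≤ R → ∃ K : ℕ, ∀ k ≥ K,
        |(∫ x in ann (R * r k) R₀, eDen (ε k) (u k) x)
          - 2 * μ * ∫ x : E2, ‖lap ω x‖ ^ 2| < η := by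
  intro η hη
  have hlog : Tendsto (fun k => Real.log (1 / r k)) atTop atTop := by
    refine Real.tendsto_log_atTop.comp ?_
    simp only [one_div]
    exact (tendsto_nhdsWithin_iff.2 ⟨hr0, Eventually.of_forall hrpos⟩).inv_tendsto_nhdsGT_zero
  have hq0 : ∀ k, 0 < ε k / r k ^ 2 := fun k => div_pos (hεpos k) (pow_pos (hrpos k) 2)
  have hμ0 : 0 ≤ μ := ge_of_tendsto hμ <| by
    filter_upwards [hlog.eventually_ge_atTop 0] with k hk using mul_nonneg (hq0 k).le hk
  have hq : Tendsto (fun k => ε k / r k ^ 2) atTop (nhds 0) := by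
    have := hμ.mul hlog.inv_tendsto_atTop
    rw [mul_zero] at this
    refine this.congr' ?_
    filter_upwards [hlog.eventually_gt_atTop 0] with k hk
    rw [Pi.inv_apply, mul_assoc, mul_inv_cancel₀ hk.ne', mul_one]
  choose v hv hvu using fun k => exists_contDiff_eqOn_ball (hsm k)
  obtain ⟨δ, hδ, hδ1, hδη⟩ : ∃ δ : ℝ, 0 < δ ∧ δ ≤ 1 / 400 ∧ 200000 * δ * (2 + μ) ≤ η / 4 := by
    refine ⟨min (1 / 400) (η / (800000 * (2 + μ))), by positivity, min_le_left _ _, ?_⟩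
    calc _ ≤ 200000 * (η / (800000 * (2 + μ))) * (2 + μ) := by gcongr; exact min_le_right _ _
      _ = η / 4 := by field_simp; norm_num
  obtain ⟨R₁, hR₁, ρ, hρ, K₁, hK₁⟩ := hneck δ hδ
  refine ⟨ρ / 4, by linarith [hρ.1], fun R₀ hR₀ hR₀ρ => ?_⟩
  obtain ⟨R₂, hR₂⟩ := Metric.tendsto_atTop.1
    ((tendsto_setIntegral_ball_atTop hωI).const_mul (2 * μ)) (η / 2) (half_pos hη)
  refine ⟨max 1 (max (2 * R₁) R₂), le_max_left _ _, fun R hR => ?_⟩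
  have hR1 : 1 ≤ R := (le_max_left _ _).trans hR
  have hR2 : 2 * R₁ ≤ R := (le_max_left _ _).trans ((le_max_right _ _).trans hR)
  have htail := hR₂ R ((le_max_right _ _).trans ((le_max_right _ _).trans hR))
  have hRpos : 0 < R := one_pos.trans_le hR1
  have hRr : Tendsto (fun k => R * r k) atTop (nhds 0) := by simpa using hr0.const_mul R
  have hX : Tendsto (fun k => ε k / r k ^ 2 * Real.log (R₀ / (R * r k))) atTop (nhds μ) := by
    have := hμ.add (hq.mul_const (Real.log (R₀ / R)))
    rw [zero_mul, add_zero] at this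
    refine this.congr fun k => ?_
    have hr := hrpos k
    rw [← mul_add, ← Real.log_mul (by positivity) (by positivity)]
    congr 2
    field_simp
  have hM : Tendsto (fun k => ∫ t in (0 : ℝ)..R,
      t * circ (fun x => ‖lap (fun z => v k (r k • z)) x‖ ^ 2) t) atTop
      (nhds (∫ x in ball (0 : E2) R, ‖lap ω x‖ ^ 2)) := by
    refine tendsto_integral_circ_lap (fun k => (hv k).comp (contDiff_const_smul (r k))) hω
      hRpos.le ((hconv _ (isCompact_closedBall 0 R) 2 (by norm_num)).congr ?_)
    filter_upwards [hRr.eventually (gt_mem_nhds (by norm_num : (0 : ℝ) < 1 / 2))] with k hk y hy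
    have hy' : r k • y ∈ ball (0 : E2) (1 / 2) := by
      rw [mem_ball_zero_iff, norm_smul, Real.norm_of_nonneg (hrpos k).le]
      rw [mem_closedBall_zero_iff] at hy
      nlinarith [hrpos k]
    have e : (fun z => u k (r k • z)) =ᶠ[nhds y] fun z => v k (r k • z) :=
      ((continuous_const_smul (r k)).tendsto y).eventually
        ((hvu k).symm.eventuallyEq_of_mem (isOpen_ball.mem_nhds hy'))
    exact (e.iteratedFDeriv ℝ 2).eq_of_nhds
  have hlim := (hX.const_mul 2).mul hM
  obtain ⟨K, hK⟩ := eventually_atTop.1 <| (eventually_ge_atTop K₁).and <|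
    (hRr.eventually (gt_mem_nhds hR₀)).and <| (hq.eventually (gt_mem_nhds one_pos)).and <|
    (hX.eventually (gt_mem_nhds (lt_add_one μ))).and <|
    Metric.tendsto_nhds.1 hlim (η / 4) (by positivity)
  refine ⟨K, fun k hk => ?_⟩
  obtain ⟨hkK, hkR, hkq, hkX, hkM⟩ := hK k hk
  rw [div_lt_one (pow_pos (hrpos k) 2)] at hkq
  have key := neck_estimate_comp_smul (s := Real.sqrt δ) (hv k) (hvu k) (hsph k) (hharm k)
    (hεpos k).le (hrpos k) hR1 hkR.le (by linarith [hρ.2]) hkq.le (Real.sqrt_nonneg δ)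
    (by rwa [Real.sq_sqrt hδ.le]) fun t ht x hx hx' => (hK₁ k hkK).1 t ht x
      ((mul_le_mul_of_nonneg_right hR2 (hrpos k).le).trans hx) (hx'.trans hR₀ρ.le)
  rw [Real.sq_sqrt hδ.le] at key
  have hsmall : 200000 * δ * (1 + ε k / r k ^ 2 * Real.log (R₀ / (R * r k))) ≤ η / 4 := by
    refine le_trans ?_ hδη
    exact mul_le_mul_of_nonneg_left (by linarith) (by positivity)
  rw [Real.dist_eq, abs_lt] at htail hkM
  rw [abs_le] at key
  rw [abs_lt]
  constructor <;> linarith [key.1, key.2, htail.1, htail.2, hkM.1, hkM.2]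

end
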